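/- Let K be a complete discrete valuation field with perfect residue field k of characteristic p > 0, and let L/K be a finite wild Galois extension with a unique jump in the ramification filtration of its Galois group; set m = u_{L/K} (an integer > 1). If L/K satisfies (P_m^tr), then k has no Galois extension of degree p. -/

import Mathlib

noncomputable section

open scoped Classical

set_option synthInstance.maxHeartbeats 400000

namespace Fontaine

/-! ### The ambient setting

`K` is a field, `Ω` a fixed algebraic closure of `K`, and `v : Ω → ℝ` is (the unique)
additive valuation on `Ω` extending the normalized discrete valuation of `K`
(so that `v (K^×) = ℤ`), with `K` complete.  Algebraic extensions `E / K` are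
intermediate fields of `Ω / K`. -/

/-- `v` is an additive valuation on `Ω`, extending the normalized discrete valuation
of the complete field `K` (the value of `v` at `0` is irrelevant junk). The
Galois-invariance and completeness clauses are true (and uniquely determining)
properties of this situation. -/
structure IsCDV (K Ω : Type) [Field K] [Field Ω] [Algebra K Ω] (v : Ω → ℝ) : Prop where
  map_mul : ∀ x y : Ω, x ≠ 0 → y ≠ 0 → v (x * y) = v x + v y
  add_ge : ∀ x y : Ω, x ≠ 0 → y ≠ 0 → x + y ≠ 0 → min (v x) (v y) ≤ v (x + y)
  int_valued : ∀ x : K, x ≠ 0 → ∃ n : ℤ, v (algebraMap K Ω x) = (n : ℝ)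
  exists_uniformizer : ∃ x : K, v (algebraMap K Ω x) = 1
  galois_inv : ∀ (E : IntermediateField K Ω) (σ : ↥E ≃ₐ[K] ↥E) (x : ↥E),
    v ((σ x : Ω)) = v (x : Ω)
  complete : ∀ x : ℕ → K,
    (∀ N : ℝ, ∃ n₀ : ℕ, ∀ i j : ℕ, n₀ ≤ i → n₀ ≤ j →
      x i = x j ∨ N ≤ v (algebraMap K Ω (x i - x j))) →
    ∃ y : K, ∀ N : ℝ, ∃ n₀ : ℕ, ∀ i : ℕ, n₀ ≤ i →
      x i = y ∨ N ≤ v (algebraMap K Ω (x i - y))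

variable {K Ω : Type} [Field K] [Field Ω] [Algebra K Ω] (v : Ω → ℝ)

/-- `x` belongs to the ring of integers `O_E` of `E`. -/
def IsInt (E : IntermediateField K Ω) (x : Ω) : Prop :=
  x ∈ E ∧ (x = 0 ∨ 0 ≤ v x)

/-- The minimal positive value of `v` on `F`; it equals `1 / e_{F/K}`. -/
def minVal (F : IntermediateField K Ω) : ℝ :=
  sInf {r : ℝ | 0 < r ∧ ∃ x ∈ F, v x = r}

/-- The ramification index `e_{F/K}`. -/
def ramIdx (F : IntermediateField K Ω) : ℝ := (minVal v F)⁻¹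

/-- The valuation normalized with respect to the base field `F`
(so that `vRel v F (F^×) = ℤ`); this is `v_F`. -/
def vRel (F : IntermediateField K Ω) (x : Ω) : ℝ := v x * ramIdx v F

/-- `x` lies in the ideal `a_{E/F}^m = {x ∈ O_E : v_F x ≥ m}` (valuation condition). -/
def InId (F : IntermediateField K Ω) (m : ℝ) (x : Ω) : Prop :=
  x = 0 ∨ m ≤ vRel v F x

/-- `f : Ω → Ω` is a set-theoretic representative of an `O_F`-algebra homomorphism
`O_L → O_E / a_{E/F}^m`. -/
def IsHomMod (F L E : IntermediateField K Ω) (m : ℝ) (f : Ω → Ω) : Prop :=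
  (∀ x, IsInt v L x → IsInt v E (f x)) ∧
  (∀ x y, IsInt v L x → IsInt v L y → InId v F m (f (x + y) - (f x + f y))) ∧
  (∀ x y, IsInt v L x → IsInt v L y → InId v F m (f (x * y) - f x * f y)) ∧
  InId v F m (f 1 - 1) ∧
  (∀ c, IsInt v F c → InId v F m (f c - c))

/-- There exists an `O_F`-algebra homomorphism `O_L → O_E / a_{E/F}^m`. -/
def HomMod (F L E : IntermediateField K Ω) (m : ℝ) : Prop :=
  ∃ f : Ω → Ω, IsHomMod v F L E m f

/-- Fontaine's property (P_m) for the extension `L / F`. -/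
def PropP (F L : IntermediateField K Ω) (m : ℝ) : Prop :=
  ∀ E : IntermediateField K Ω, F ≤ E → HomMod v F L E m → L ≤ E

/-- `E / F` is totally ramified: the residue extension is trivial. -/
def TotRam (F E : IntermediateField K Ω) : Prop :=
  ∀ x, IsInt v E x → ∃ c, c ∈ F ∧ (c = 0 ∨ 0 ≤ v c) ∧ (x - c = 0 ∨ 0 < v (x - c))

/-- Property (P_m^tr) for `L / F`: (P_m) restricted to totally ramified `E / F`. -/
def PropPtr (F L : IntermediateField K Ω) (m : ℝ) : Prop :=
  ∀ E : IntermediateField K Ω, F ≤ E → TotRam v F E → HomMod v F L E m → L ≤ E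

/-- `E / F` is unramified: `F ≤ E` and the value group does not grow
(the residue fields being perfect, this is the usual notion). -/
def Unram (F E : IntermediateField K Ω) : Prop :=
  F ≤ E ∧ ∀ x : Ω, x ∈ E → x ≠ 0 → ∃ n : ℤ, vRel v F x = (n : ℝ)

/-- The elements of `Gal(L/K)` fixing `F` pointwise, i.e. `Gal(L/F)`. -/
def relGal (F L : IntermediateField K Ω) : Set (↥L ≃ₐ[K] ↥L) :=
  {σ | ∀ x : ↥L, (x : Ω) ∈ F → σ x = x}

/-- `σ` lies in the ramification group `Gal(L/F)_{(i)}` in Fontaine's lower numbering: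
`σ ∈ Gal(L/F)` and `v_F (σ x - x) ≥ i` for all integers `x` of `L`. -/
def lowerAt (F L : IntermediateField K Ω) (σ : ↥L ≃ₐ[K] ↥L) (i : ℝ) : Prop :=
  σ ∈ relGal F L ∧
    ∀ x : ↥L, IsInt v L (x : Ω) → (σ x = x ∨ i ≤ vRel v F ((σ x : Ω) - (x : Ω)))

/-- Fontaine's function `i_{L/F}(σ) = min_{x ∈ O_L} v_F (σ x - x)`. -/
def iFon (F L : IntermediateField K Ω) (σ : ↥L ≃ₐ[K] ↥L) : ℝ :=
  sSup {i : ℝ | lowerAt v F L σ i}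

/-- `i_{L/F}`: the largest `i` with `Gal(L/F)_{(i)}` nontrivial. -/
def iBreak (F L : IntermediateField K Ω) : ℝ :=
  sSup {i : ℝ | ∃ σ : ↥L ≃ₐ[K] ↥L, σ ≠ 1 ∧ lowerAt v F L σ i}

/-- Fontaine's Herbrand function `φ̃_{L/F}(t) = t + ∑_{1 ≠ σ ∈ Gal(L/F)} min (i_{L/F}(σ)) t`
(valid for `t ≥ 0` when the residue extension is separable). -/
def phiT (F L : IntermediateField K Ω) (t : ℝ) : ℝ :=
  t + ∑ᶠ σ ∈ {σ : ↥L ≃ₐ[K] ↥L | σ ∈ relGal F L ∧ σ ≠ 1}, min (iFon v F L σ) t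

/-- The maximal upper ramification break `u_{L/F} = φ̃_{L/F}(i_{L/F})`
(in Fontaine's numbering). -/
def uBreak (F L : IntermediateField K Ω) : ℝ := phiT v F L (iBreak v F L)

/-- Fontaine's inverse Herbrand function `ψ̃_{L/F}`. -/
def psiT (F L : IntermediateField K Ω) (u : ℝ) : ℝ :=
  sInf {t : ℝ | 0 ≤ t ∧ u ≤ phiT v F L t}

/-- Serre's inverse Herbrand function `ψ_{L/K}(u) = e_{L/K} ψ̃_{L/K}(u+1) - 1`. -/
def serrePsi (L : IntermediateField K Ω) (u : ℝ) : ℝ :=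
  ramIdx v L * psiT v ⊥ L (u + 1) - 1

/-- `L/K` has a unique jump in the ramification filtration of its Galois group:
`Gal(L/K)^{(u)} = Gal(L/K)` for all `u ≤ u_{L/K}`; equivalently, all
`i_{L/K}(σ)`, `σ ≠ 1`, are equal to `i_{L/K}`. -/
def UniqueJump (L : IntermediateField K Ω) : Prop :=
  ∀ σ : ↥L ≃ₐ[K] ↥L, σ ≠ 1 → iFon v ⊥ L σ = iBreak v ⊥ L

/-- The fixed field `M` of `Gal(L/K)^{(u_{L/K})} = Gal(L/K)_{(i_{L/K})}` inside `L`,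
as an intermediate field of `Ω / K`. -/
def ramFixed (L : IntermediateField K Ω) : IntermediateField K Ω where
  carrier := {x : Ω | ∃ hx : x ∈ L, ∀ σ : ↥L ≃ₐ[K] ↥L,
    lowerAt v ⊥ L σ (iBreak v ⊥ L) → σ ⟨x, hx⟩ = ⟨x, hx⟩}
  mul_mem' := by
    rintro a b ⟨ha, pa⟩ ⟨hb, pb⟩
    refine ⟨mul_mem ha hb, fun σ hσ => ?_⟩
    have h : (⟨a * b, mul_mem ha hb⟩ : ↥L) = ⟨a, ha⟩ * ⟨b, hb⟩ := rfl
    rw [h, map_mul, pa σ hσ, pb σ hσ]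
  one_mem' := by
    refine ⟨one_mem L, fun σ hσ => ?_⟩
    have h : (⟨(1 : Ω), one_mem L⟩ : ↥L) = 1 := rfl
    rw [h, map_one]
  add_mem' := by
    rintro a b ⟨ha, pa⟩ ⟨hb, pb⟩
    refine ⟨add_mem ha hb, fun σ hσ => ?_⟩
    have h : (⟨a + b, add_mem ha hb⟩ : ↥L) = ⟨a, ha⟩ + ⟨b, hb⟩ := rfl
    rw [h, map_add, pa σ hσ, pb σ hσ]
  zero_mem' := by
    refine ⟨zero_mem L, fun σ hσ => ?_⟩
    have h : (⟨(0 : Ω), zero_mem L⟩ : ↥L) = 0 := rfl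
    rw [h, map_zero]
  algebraMap_mem' := by
    intro r
    refine ⟨IntermediateField.algebraMap_mem L r, fun σ hσ => ?_⟩
    have h : (⟨algebraMap K Ω r, IntermediateField.algebraMap_mem L r⟩ : ↥L)
        = algebraMap K ↥L r := rfl
    rw [h, AlgEquiv.commutes]
  inv_mem' := by
    rintro a ⟨ha, pa⟩
    refine ⟨IntermediateField.inv_mem L ha, fun σ hσ => ?_⟩
    have h : (⟨a⁻¹, IntermediateField.inv_mem L ha⟩ : ↥L) = (⟨a, ha⟩ : ↥L)⁻¹ := by
      apply Subtype.ext
      rw [IntermediateField.coe_inv]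
    rw [h, map_inv₀, pa σ hσ]

section Res

variable {Ω : Type} [Field Ω] (v : Ω → ℝ) (K : Type) [Field K] [Algebra K Ω]

/-- `x ∈ K` is an integer of `K`. -/
def IsIntK (x : K) : Prop := x = 0 ∨ 0 ≤ v (algebraMap K Ω x)

/-- The residue field of `K` has characteristic `p`. -/
def ResidueCharP (p : ℕ) : Prop :=
  (p : K) = 0 ∨ 0 < v (algebraMap K Ω (p : K))

/-- The Frobenius of the residue field of `K` at `p` is surjective. -/
def PerfectResidueAt (p : ℕ) : Prop :=
  ∀ x : K, IsIntK v K x → ∃ y : K, IsIntK v K y ∧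
    (x - y ^ p = 0 ∨ 0 < v (algebraMap K Ω (x - y ^ p)))

/-- The residue field of `K` is perfect. -/
def PerfectResidue : Prop :=
  ∀ p : ℕ, p.Prime → ResidueCharP v K p → PerfectResidueAt v K p

/-- The residue field of `K` is algebraically closed. -/
def ResidueAlgClosed : Prop :=
  ∀ q : Polynomial K, q.Monic → 0 < q.natDegree → (∀ i, IsIntK v K (q.coeff i)) →
    ∃ x : K, IsIntK v K x ∧
      (Polynomial.eval x q = 0 ∨ 0 < v (algebraMap K Ω (Polynomial.eval x q)))

/-- `ρ : K → k` realizes `k` as the residue field of `K`: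
on the integers of `K` it is the residue (reduction) map. -/
def IsResidueMap {k : Type} [Field k] (ρ : K → k) : Prop :=
  (∀ x y : K, IsIntK v K x → IsIntK v K y → ρ (x + y) = ρ x + ρ y) ∧
  (∀ x y : K, IsIntK v K x → IsIntK v K y → ρ (x * y) = ρ x * ρ y) ∧
  ρ 1 = 1 ∧
  (∀ a : k, ∃ x : K, IsIntK v K x ∧ ρ x = a) ∧
  (∀ x : K, IsIntK v K x → (ρ x = 0 ↔ (x = 0 ∨ 0 < v (algebraMap K Ω x))))

/-- The group `U_K^n` of `n`-th principal units of `K` (for `n ≥ 1`),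
as a subgroup of `Kˣ`. -/
def prinK (n : ℝ) : Subgroup Kˣ :=
  Subgroup.closure {u : Kˣ | (u : K) = 1 ∨ n ≤ v (algebraMap K Ω ((u : K) - 1))}

end Res

/-- The group `U_E^n` of `n`-th principal units of an intermediate field `E`
(for `n ≥ 1`), with respect to the normalized valuation `v_E` of `E`,
as a subgroup of `(↥E)ˣ`. -/
def prinE {K Ω : Type} [Field K] [Field Ω] [Algebra K Ω] (v : Ω → ℝ)
    (E : IntermediateField K Ω) (n : ℝ) : Subgroup (↥E)ˣ :=
  Subgroup.closure {u : (↥E)ˣ | ((u : ↥E) : Ω) = 1 ∨ n ≤ vRel v E (((u : ↥E) : Ω) - 1)}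

end Fontaine

open Fontaine

namespace Fontaine

open Polynomial IntermediateField

/-- In a Galois extension of prime degree `p` in characteristic `p`, some automorphism has
fixed field `k` and acts on some element as translation by `1`. -/
lemma exists_aut_eq_add_one {k l : Type*} [Field k] [Field l] [Algebra k l] [IsGalois k l]
    {p : ℕ} (hp : p.Prime) [CharP k p] (hfr : Module.finrank k l = p) :
    ∃ (τ : l ≃ₐ[k] l) (θ : l), τ θ = θ + 1 ∧
      ∀ x, τ x = x → x ∈ Set.range (algebraMap k l) := by
  have : Fact p.Prime := ⟨hp⟩
  have : FiniteDimensional k l := Module.finite_of_finrank_pos (hfr ▸ hp.pos)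
  have hcard : Nat.card (l ≃ₐ[k] l) = p := by rw [IsGalois.card_aut_eq_finrank, hfr]
  have : Nontrivial (l ≃ₐ[k] l) := by
    rw [← Finite.one_lt_card_iff_nontrivial, hcard]; exact hp.one_lt
  obtain ⟨τ, hτ⟩ := exists_ne (1 : l ≃ₐ[k] l)
  have hfix : ∀ x : l, τ x = x → x ∈ Set.range (algebraMap k l) := by
    intro x hx
    rw [IsGalois.mem_range_algebraMap_iff_fixed]
    intro σ
    have hσ : σ ∈ Subgroup.zpowers τ := by
      rw [zpowers_eq_top_of_prime_card hcard hτ]; trivial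
    have : Subgroup.zpowers τ ≤ MulAction.stabilizer (l ≃ₐ[k] l) x := by
      rw [Subgroup.zpowers_le]; exact hx
    exact this hσ
  let D : Module.End k l := τ.toLinearMap - 1
  have : CharP (Module.End k l) p := charP_of_injective_algebraMap
    (algebraMap k (Module.End k l)).injective p
  have hτp : (τ.toLinearMap : Module.End k l) ^ p = 1 := by
    have h1 : τ ^ p = 1 := by rw [← hcard]; exact pow_card_eq_one'
    ext x
    have : ∀ (n : ℕ), ((τ.toLinearMap : Module.End k l) ^ n) x = (τ ^ n) x := by
      intro n
      induction n with
      | zero => simp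
      | succ n ih => rw [pow_succ', pow_succ', Module.End.mul_apply, ih]; rfl
    rw [this, h1]; rfl
  have hD : D ^ p = 0 := by
    rw [sub_pow_char_of_commute p (Commute.one_right _), hτp, one_pow, sub_self]
  have hD1 : D ≠ 0 := by
    intro h
    apply hτ
    ext x
    have := LinearMap.congr_fun h x
    simpa [D, sub_eq_zero] using this
  have hex : ∃ n, D ^ n = 0 := ⟨p, hD⟩
  classical
  obtain ⟨n, hn⟩ : ∃ n, Nat.find hex = n + 2 := by
    have h0 : Nat.find hex ≠ 0 := fun h => by
      have := Nat.find_spec hex; rw [h, pow_zero] at this; exact one_ne_zero this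
    have h1 : Nat.find hex ≠ 1 := fun h => by
      have := Nat.find_spec hex; rw [h, pow_one] at this; exact hD1 this
    exact ⟨Nat.find hex - 2, by omega⟩
  have hz : D ^ (n + 2) = 0 := hn ▸ Nat.find_spec hex
  have hnz : D ^ (n + 1) ≠ 0 := Nat.find_min hex (by omega)
  obtain ⟨y, hy⟩ : ∃ y, (D ^ (n + 1)) y ≠ 0 := by
    by_contra! h; exact hnz (LinearMap.ext h)
  set u := (D ^ n) y
  have hu : D u = (D ^ (n + 1)) y := by rw [pow_succ', Module.End.mul_apply]
  have hu2 : D (D u) = 0 := by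
    have := LinearMap.congr_fun hz y
    rwa [pow_succ', Module.End.mul_apply, ← hu] at this
  obtain ⟨d, hd⟩ := hfix (D u) (by simpa [D, sub_eq_zero] using hu2)
  have hd0 : algebraMap k l d ≠ 0 := by rw [hd, hu]; exact hy
  refine ⟨τ, u / algebraMap k l d, ?_, hfix⟩
  rw [map_div₀, AlgEquiv.commutes]
  have : τ u = u + algebraMap k l d := by rw [hd]; simp [D]
  rw [this, add_div, div_self hd0]

/-- If the polynomial `∏ (X - a g)`, where `a` embeds a nontrivial finite group into the additive
group of `k`, is surjective on `k`, then `k` has no Galois extension of degree `p`. -/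
lemma finrank_ne_of_prod_sub_surjective {k l G : Type*} [Field k] [Field l] [Algebra k l]
    [IsGalois k l] {p : ℕ} (hp : p.Prime) [CharP k p] [Group G] [Fintype G] [Nontrivial G]
    (a : G → k) (ha : Function.Injective a) (hmul : ∀ g h, a (g * h) = a g + a h)
    (hsurj : ∀ c, ∃ w, ∏ g, (w - a g) = c) : Module.finrank k l ≠ p := by
  classical
  intro hfr
  obtain ⟨τ, θ₀, hθ₀, hfix⟩ := exists_aut_eq_add_one (l := l) hp hfr
  obtain ⟨g₀, hg₀⟩ := exists_ne (1 : G)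
  have h1 : a 1 = 0 := by simpa using hmul 1 1
  have hag : a g₀ ≠ 0 := fun h => hg₀ (ha (h.trans h1.symm))
  have hinv : ∀ g, a g⁻¹ = - a g := fun g => by
    have := hmul g⁻¹ g; rw [inv_mul_cancel, h1] at this; exact eq_neg_of_add_eq_zero_left this.symm
  set θ := algebraMap k l (a g₀) * θ₀
  have hθ : τ θ = θ + algebraMap k l (a g₀) := by
    simp only [θ, map_mul, AlgEquiv.commutes, hθ₀]; ring
  have : FiniteDimensional k l := Module.finite_of_finrank_pos (hfr ▸ hp.pos)
  let A : k[X] := ∏ g, (X - C (a g))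
  have hshift : ∀ (w : k) (h : G), A.eval (w + a h) = A.eval w := by
    intro w h
    simp only [A, eval_prod, eval_sub, eval_X, eval_C]
    refine Fintype.prod_equiv (Equiv.mulLeft h⁻¹) _ _ fun g => ?_
    rw [Equiv.coe_mulLeft, hmul, hinv]; ring
  have hfac : ∀ w : k, A - C (A.eval w) = ∏ g, (X - C (w + a g)) := by
    intro w
    have hinj : Set.InjOn (fun g : G => w + a g) (Finset.univ : Finset G) :=
      fun g _ h _ hgh => ha (add_left_cancel hgh)
    have hdA : A.Monic := monic_prod_of_monic _ _ fun g _ => monic_X_sub_C _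
    have hA : A.natDegree = Fintype.card G := by
      rw [natDegree_prod_of_monic _ _ fun g _ => monic_X_sub_C _]
      simp only [natDegree_X_sub_C, Finset.sum_const, Finset.card_univ, smul_eq_mul, mul_one]
    have hdB : (∏ g, (X - C (w + a g))).Monic := monic_prod_of_monic _ _ fun g _ => monic_X_sub_C _
    have hB : (∏ g, (X - C (w + a g))).natDegree = Fintype.card G := by
      rw [natDegree_prod_of_monic _ _ fun g _ => monic_X_sub_C _]
      simp only [natDegree_X_sub_C, Finset.sum_const, Finset.card_univ, smul_eq_mul, mul_one]
    have hlt : (C (A.eval w)).degree < A.degree := by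
      refine degree_C_le.trans_lt ?_
      rw [degree_eq_natDegree hdA.ne_zero, hA]; exact_mod_cast Fintype.card_pos
    have hmon : (A - C (A.eval w)).Monic := hdA.sub_of_left hlt
    have hdeg : (A - C (A.eval w)).natDegree = Fintype.card G := by
      rw [natDegree_sub_C, hA]
    refine eq_of_degree_sub_lt_of_eval_index_eq (s := Finset.univ) (v := fun g => w + a g)
      hinj ?_ ?_
    · rw [Finset.card_univ, ← hdeg, ← degree_eq_natDegree hmon.ne_zero]
      refine degree_sub_lt_left ?_ hmon.ne_zero (by rw [hmon.leadingCoeff, hdB.leadingCoeff])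
      rw [degree_eq_natDegree hmon.ne_zero, degree_eq_natDegree hdB.ne_zero, hdeg, hB]
    · intro g _
      rw [eval_sub, hshift, eval_C, sub_self, eval_prod]
      exact (Finset.prod_eq_zero (Finset.mem_univ g) (by simp)).symm
  have hθA : τ (∏ g, (θ - algebraMap k l (a g))) = ∏ g, (θ - algebraMap k l (a g)) := by
    rw [map_prod]
    refine Fintype.prod_equiv (Equiv.mulLeft g₀⁻¹) _ _ fun g => ?_
    rw [Equiv.coe_mulLeft, hmul, hinv, map_sub, hθ, AlgEquiv.commutes, map_add, map_neg]; ring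
  obtain ⟨c, hc⟩ := hfix _ hθA
  obtain ⟨w, hw⟩ := hsurj c
  have hAw : A.eval w = c := by
    simp only [A, eval_prod, eval_sub, eval_X, eval_C]; exact hw
  have h2 := congrArg (aeval θ) (hfac w)
  rw [hAw] at h2
  simp only [A, map_sub, map_prod, aeval_X, aeval_C, hc, sub_self] at h2
  obtain ⟨g, -, hg⟩ := Finset.prod_eq_zero_iff.1 h2.symm
  rw [sub_eq_zero.1 hg, AlgEquiv.commutes] at hθ
  apply hag
  have := left_eq_add.1 hθ
  exact (map_eq_zero _).1 this

/-- `v x ≥ r`, with the convention `v 0 = ∞`. -/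
def Ge {Ω : Type} [Field Ω] (v : Ω → ℝ) (r : ℝ) (x : Ω) : Prop := x = 0 ∨ r ≤ v x

/-- `v x > r`, with the convention `v 0 = ∞`. -/
def Gt {Ω : Type} [Field Ω] (v : Ω → ℝ) (r : ℝ) (x : Ω) : Prop := x = 0 ∨ r < v x

section Basic

variable {K Ω : Type} [Field K] [Field Ω] [Algebra K Ω] {v : Ω → ℝ}

lemma Ge.gt {r s : ℝ} {x : Ω} (h : Ge v r x) (hs : s < r) : Gt v s x := h.imp_right hs.trans_le
lemma Gt.ge {r : ℝ} {x : Ω} (h : Gt v r x) : Ge v r x := h.imp_right le_of_lt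
lemma Ge.zero {r : ℝ} : Ge v r 0 := Or.inl rfl
lemma Gt.zero {r : ℝ} : Gt v r 0 := Or.inl rfl
lemma Gt.not_le {r : ℝ} {x : Ω} (h : Gt v r x) (hx : x ≠ 0) : ¬ v x ≤ r :=
  _root_.not_le.2 (h.resolve_left hx)

variable (hv : IsCDV K Ω v)
include hv

lemma IsCDV.map_one : v 1 = 0 := by
  have := hv.map_mul 1 1 one_ne_zero one_ne_zero
  rw [mul_one] at this; linarith

lemma IsCDV.map_neg (x : Ω) : v (-x) = v x := by
  rcases eq_or_ne x 0 with rfl | hx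
  · rw [neg_zero]
  have h1 := hv.map_mul (-1) (-1) (by simp) (by simp)
  rw [neg_one_mul, neg_neg, hv.map_one] at h1
  have h2 := hv.map_mul (-1) x (by simp) hx
  rw [neg_one_mul] at h2; linarith

lemma IsCDV.map_pow {x : Ω} (hx : x ≠ 0) (n : ℕ) : v (x ^ n) = n * v x := by
  induction n with
  | zero => simp [hv.map_one]
  | succ n ih => rw [pow_succ, hv.map_mul _ _ (pow_ne_zero n hx) hx, ih]; push_cast; ring

lemma IsCDV.map_inv {x : Ω} (hx : x ≠ 0) : v x⁻¹ = - v x := by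
  have := hv.map_mul x x⁻¹ hx (inv_ne_zero hx)
  rw [mul_inv_cancel₀ hx, hv.map_one] at this; linarith

lemma IsCDV.map_prod {ι : Type*} (s : Finset ι) (f : ι → Ω) (h : ∀ i ∈ s, f i ≠ 0) :
    v (∏ i ∈ s, f i) = ∑ i ∈ s, v (f i) := by
  induction s using Finset.induction_on with
  | empty => simp [hv.map_one]
  | insert a s ha ih =>
    rw [Finset.prod_insert ha, Finset.sum_insert ha,
      hv.map_mul _ _ (h a (by simp)) (Finset.prod_ne_zero_iff.2 fun i hi => h i (by simp [hi])),
      ih fun i hi => h i (by simp [hi])]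

lemma IsCDV.ge_add {r : ℝ} {x y : Ω} (hx : Ge v r x) (hy : Ge v r y) : Ge v r (x + y) := by
  by_cases hx0 : x = 0
  · simpa [hx0] using hy
  by_cases hy0 : y = 0
  · simpa [hy0] using hx
  by_cases h : x + y = 0
  · exact Or.inl h
  exact Or.inr ((le_min (hx.resolve_left hx0) (hy.resolve_left hy0)).trans
    (hv.add_ge x y hx0 hy0 h))

lemma IsCDV.gt_add {r : ℝ} {x y : Ω} (hx : Gt v r x) (hy : Gt v r y) : Gt v r (x + y) := by
  by_cases hx0 : x = 0
  · simpa [hx0] using hy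
  by_cases hy0 : y = 0
  · simpa [hy0] using hx
  by_cases h : x + y = 0
  · exact Or.inl h
  exact Or.inr ((lt_min (hx.resolve_left hx0) (hy.resolve_left hy0)).trans_le
    (hv.add_ge x y hx0 hy0 h))

lemma IsCDV.ge_neg {r : ℝ} {x : Ω} (hx : Ge v r x) : Ge v r (-x) := by
  simpa [Ge, hv.map_neg] using hx

lemma IsCDV.gt_neg {r : ℝ} {x : Ω} (hx : Gt v r x) : Gt v r (-x) := by
  simpa [Gt, hv.map_neg] using hx

lemma IsCDV.ge_sub {r : ℝ} {x y : Ω} (hx : Ge v r x) (hy : Ge v r y) : Ge v r (x - y) := by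
  rw [sub_eq_add_neg]; exact hv.ge_add hx (hv.ge_neg hy)

lemma IsCDV.gt_sub {r : ℝ} {x y : Ω} (hx : Gt v r x) (hy : Gt v r y) : Gt v r (x - y) := by
  rw [sub_eq_add_neg]; exact hv.gt_add hx (hv.gt_neg hy)

lemma IsCDV.ge_sum {ι : Type*} {r : ℝ} (s : Finset ι) (f : ι → Ω) (h : ∀ i ∈ s, Ge v r (f i)) :
    Ge v r (∑ i ∈ s, f i) :=
  Finset.sum_induction f (Ge v r) (fun _ _ => hv.ge_add) Ge.zero h

lemma IsCDV.gt_sum {ι : Type*} {r : ℝ} (s : Finset ι) (f : ι → Ω) (h : ∀ i ∈ s, Gt v r (f i)) :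
    Gt v r (∑ i ∈ s, f i) :=
  Finset.sum_induction f (Gt v r) (fun _ _ => hv.gt_add) Gt.zero h

lemma IsCDV.ge_mul {r s : ℝ} {x y : Ω} (hx : Ge v r x) (hy : Ge v s y) :
    Ge v (r + s) (x * y) := by
  by_cases hx0 : x = 0
  · simp [hx0, Ge]
  by_cases hy0 : y = 0
  · simp [hy0, Ge]
  refine Or.inr ?_
  rw [hv.map_mul x y hx0 hy0]
  exact add_le_add (hx.resolve_left hx0) (hy.resolve_left hy0)

lemma IsCDV.gt_mul {r s : ℝ} {x y : Ω} (hx : Gt v r x) (hy : Ge v s y) :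
    Gt v (r + s) (x * y) := by
  by_cases hx0 : x = 0
  · simp [hx0, Gt]
  by_cases hy0 : y = 0
  · simp [hy0, Gt]
  refine Or.inr ?_
  rw [hv.map_mul x y hx0 hy0]
  exact add_lt_add_of_lt_of_le (hx.resolve_left hx0) (hy.resolve_left hy0)

lemma IsCDV.ge_one : Ge v 0 1 := Or.inr hv.map_one.ge

lemma IsCDV.ge_pow {r : ℝ} {x : Ω} (hx : Ge v r x) (n : ℕ) : Ge v (n * r) (x ^ n) := by
  induction n with
  | zero => simpa using hv.ge_one
  | succ n ih => rw [pow_succ]; push_cast; rw [add_mul, one_mul]; exact hv.ge_mul ih hx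

/-- If the nonzero terms of a sum have pairwise distinct valuations, each of them has valuation
at least that of the sum. -/
lemma IsCDV.ge_of_ge_sum {ι : Type*} (s : Finset ι) (z : ι → Ω) {r : ℝ}
    (hd : ∀ i ∈ s, ∀ j ∈ s, z i ≠ 0 → z j ≠ 0 → v (z i) = v (z j) → i = j)
    (h : Ge v r (∑ i ∈ s, z i)) : ∀ i ∈ s, Ge v r (z i) := by
  by_contra! hcon
  obtain ⟨i₀, hi₀, hi⟩ := hcon
  simp only [Ge, not_or, not_le] at hi
  have hne : (s.filter fun i => z i ≠ 0).Nonempty := ⟨i₀, by simp [hi₀, hi.1]⟩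
  obtain ⟨j, hj, hmin⟩ := Finset.exists_min_image _ (fun i => v (z i)) hne
  simp only [Finset.mem_filter] at hj hmin
  have hjr : v (z j) < r := (hmin i₀ ⟨hi₀, hi.1⟩).trans_lt hi.2
  have hrest : Gt v (v (z j)) (∑ i ∈ s.erase j, z i) := by
    refine hv.gt_sum _ _ fun i his => ?_
    rw [Finset.mem_erase] at his
    by_cases h0 : z i = 0
    · exact Or.inl h0
    · exact Or.inr (lt_of_le_of_ne (hmin i ⟨his.2, h0⟩)
        fun he => his.1 (hd i his.2 j hj.1 h0 hj.2 he.symm))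
  have : Gt v (v (z j)) (z j) := by
    have h1 := hv.gt_sub (h.gt hjr) hrest
    rwa [← Finset.add_sum_erase s z hj.1, add_sub_cancel_right] at h1
  exact this.not_le hj.2 le_rfl

/-- Terms `cⱼ x ^ j`, `j < n`, with `cⱼ ∈ K` and `v x = 1 / n` have distinct valuations. -/
lemma IsCDV.ge_term_of_ge_sum {n : ℕ} {x : Ω} (hx0 : x ≠ 0) (hx : n * v x = 1) (c : ℕ → K)
    {r : ℝ} (h : Ge v r (∑ j ∈ Finset.range n, algebraMap K Ω (c j) * x ^ j)) :
    ∀ j < n, Ge v r (algebraMap K Ω (c j) * x ^ j) := by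
  have key := hv.ge_of_ge_sum (Finset.range n) (fun j => algebraMap K Ω (c j) * x ^ j) ?_ h
  · exact fun j hj => key j (Finset.mem_range.2 hj)
  have hn : (0 : ℝ) < n := by
    rcases Nat.eq_zero_or_pos n with rfl | h
    · simp at hx
    · exact_mod_cast h
  intro i hi j hj hi0 hj0 hij
  rw [Finset.mem_range] at hi hj
  have hci : algebraMap K Ω (c i) ≠ 0 := left_ne_zero_of_mul hi0
  have hcj : algebraMap K Ω (c j) ≠ 0 := left_ne_zero_of_mul hj0
  obtain ⟨a, ha⟩ := hv.int_valued (c i) (fun h => hci (by rw [h, map_zero]))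
  obtain ⟨b, hb⟩ := hv.int_valued (c j) (fun h => hcj (by rw [h, map_zero]))
  rw [hv.map_mul _ _ hci (pow_ne_zero i hx0), hv.map_mul _ _ hcj (pow_ne_zero j hx0),
    hv.map_pow hx0, hv.map_pow hx0, ha, hb] at hij
  have h1 : (a * n + i : ℤ) = b * n + j := by
    have : (a * n + i : ℝ) = b * n + j := by
      linear_combination (n : ℝ) * hij + (j - i : ℝ) * hx
    exact_mod_cast this
  have h2 : ((i : ℤ) - j) = (b - a) * n := by linarith
  have h3 : (b - a) = 0 := by
    by_contra hne
    have : (n : ℤ) ≤ |(b - a) * n| := by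
      rw [abs_mul, Nat.abs_cast]; nlinarith [Int.one_le_abs hne, (by omega : (0:ℤ) < n)]
    rw [← h2, le_abs] at this; omega
  rw [h3] at h2; omega

/-- If `v x = 1 / n`, then `1, x, …, x ^ (n - 1)` generate the integers of their `K`-span. -/
lemma IsCDV.ge_coeff_of_ge_sum {n : ℕ} {x : Ω} (hx0 : x ≠ 0) (hx : n * v x = 1) (c : ℕ → K)
    (h : Ge v 0 (∑ j ∈ Finset.range n, algebraMap K Ω (c j) * x ^ j)) :
    ∀ j < n, Ge v 0 (algebraMap K Ω (c j)) := by
  intro j hj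
  have h1 := hv.ge_term_of_ge_sum hx0 hx c h j hj
  rcases eq_or_ne (c j) 0 with hc | hc
  · exact Or.inl (by rw [hc, map_zero])
  have hc' : algebraMap K Ω (c j) ≠ 0 := by simpa using hc
  obtain ⟨a, ha⟩ := hv.int_valued (c j) hc
  have h2 := h1.resolve_left (mul_ne_zero hc' (pow_ne_zero j hx0))
  rw [hv.map_mul _ _ hc' (pow_ne_zero j hx0), hv.map_pow hx0, ha] at h2
  refine Or.inr ?_
  rw [ha]
  have hj' : (j : ℝ) < n := by exact_mod_cast hj
  have hpos : 0 < v x := by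
    by_contra hneg; push Not at hneg; nlinarith [(Nat.cast_nonneg n : (0:ℝ) ≤ n)]
  have : (-1 : ℝ) < a := by nlinarith
  have : (-1 : ℤ) < a := by exact_mod_cast this
  exact_mod_cast (by omega : 0 ≤ a)

lemma IsCDV.coeff_eq_zero_of_sum_eq_zero {n : ℕ} {x : Ω} (hx0 : x ≠ 0) (hx : n * v x = 1)
    (c : ℕ → K) (h : ∑ j ∈ Finset.range n, algebraMap K Ω (c j) * x ^ j = 0) :
    ∀ j < n, c j = 0 := by
  intro j hj
  by_contra hc
  have hc' : algebraMap K Ω (c j) ≠ 0 := by simpa using hc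
  have := hv.ge_term_of_ge_sum hx0 hx c
    (r := v (algebraMap K Ω (c j) * x ^ j) + 1) (Or.inl h) j hj
  have := this.resolve_left (mul_ne_zero hc' (pow_ne_zero j hx0))
  linarith

end Basic

section Residue

variable {K Ω : Type} [Field K] [Field Ω] [Algebra K Ω] {v : Ω → ℝ} (hv : IsCDV K Ω v)
include hv

/-- The ring of integers of `Ω`. -/
def IsCDV.valSubring : ValuationSubring Ω where
  carrier := {x | Ge v 0 x}
  mul_mem' hx hy := by simpa using hv.ge_mul hx hy
  one_mem' := hv.ge_one
  add_mem' := hv.ge_add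
  zero_mem' := Ge.zero
  neg_mem' := hv.ge_neg
  mem_or_inv_mem' x := by
    rcases eq_or_ne x 0 with rfl | hx
    · exact Or.inl Ge.zero
    rcases le_total 0 (v x) with h | h
    · exact Or.inl (Or.inr h)
    · exact Or.inr (Or.inr (by rw [hv.map_inv hx]; linarith))

lemma IsCDV.mem_valSubring {x : Ω} : x ∈ hv.valSubring ↔ Ge v 0 x := Iff.rfl

/-- The residue field of `Ω`. -/
abbrev IsCDV.Res : Type := IsLocalRing.ResidueField hv.valSubring

/-- The reduction map of `Ω`, extended by zero to nonintegral elements. -/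
def IsCDV.res (x : Ω) : hv.Res :=
  if h : Ge v 0 x then IsLocalRing.residue hv.valSubring ⟨x, h⟩ else 0

lemma IsCDV.res_of_ge {x : Ω} (h : Ge v 0 x) :
    hv.res x = IsLocalRing.residue hv.valSubring ⟨x, h⟩ := dif_pos h

lemma IsCDV.res_add {x y : Ω} (hx : Ge v 0 x) (hy : Ge v 0 y) :
    hv.res (x + y) = hv.res x + hv.res y := by
  rw [hv.res_of_ge hx, hv.res_of_ge hy, hv.res_of_ge (hv.ge_add hx hy), ← map_add]; rfl

lemma IsCDV.res_sub {x y : Ω} (hx : Ge v 0 x) (hy : Ge v 0 y) :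
    hv.res (x - y) = hv.res x - hv.res y := by
  rw [hv.res_of_ge hx, hv.res_of_ge hy, hv.res_of_ge (hv.ge_sub hx hy), ← map_sub]; rfl

lemma IsCDV.ge_zero_mul {x y : Ω} (hx : Ge v 0 x) (hy : Ge v 0 y) : Ge v 0 (x * y) := by
  simpa using hv.ge_mul hx hy

lemma IsCDV.res_mul {x y : Ω} (hx : Ge v 0 x) (hy : Ge v 0 y) :
    hv.res (x * y) = hv.res x * hv.res y := by
  rw [hv.res_of_ge hx, hv.res_of_ge hy, hv.res_of_ge (hv.ge_zero_mul hx hy), ← _root_.map_mul]; rfl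

lemma IsCDV.ge_prod {ι : Type*} (s : Finset ι) (f : ι → Ω) (h : ∀ i, Ge v 0 (f i)) :
    Ge v 0 (∏ i ∈ s, f i) :=
  hv.mem_valSubring.1 (prod_mem fun i _ => h i)

lemma IsCDV.res_prod {ι : Type*} (s : Finset ι) (f : ι → Ω) (h : ∀ i, Ge v 0 (f i)) :
    hv.res (∏ i ∈ s, f i) = ∏ i ∈ s, hv.res (f i) := by
  induction s using Finset.induction_on with
  | empty =>
    rw [Finset.prod_empty, Finset.prod_empty, hv.res_of_ge hv.ge_one]
    exact _root_.map_one _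
  | insert a s ha ih =>
    rw [Finset.prod_insert ha, Finset.prod_insert ha, hv.res_mul (h a) (hv.ge_prod s f h), ih]

lemma IsCDV.res_eq_zero_iff {x : Ω} (hx : Ge v 0 x) : hv.res x = 0 ↔ Gt v 0 x := by
  rw [hv.res_of_ge hx, IsLocalRing.residue_eq_zero_iff, IsLocalRing.mem_maximalIdeal,
    mem_nonunits_iff, not_iff_comm]
  rcases eq_or_ne x 0 with rfl | hx0
  · have : ¬ IsUnit (⟨0, hx⟩ : hv.valSubring) := fun h => h.ne_zero rfl
    simp [this, Gt.zero]
  have hx1 := hx.resolve_left hx0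
  constructor
  · intro h
    have h0 : v x = 0 := le_antisymm (not_lt.1 fun h1 => h (Or.inr h1)) hx1
    refine IsUnit.of_mul_eq_one ⟨x⁻¹, Or.inr (by rw [hv.map_inv hx0, h0, neg_zero])⟩ ?_
    exact Subtype.ext (mul_inv_cancel₀ hx0)
  · intro h hgt
    obtain ⟨y, hy⟩ := h.exists_right_inv
    have hy' : x * (y : Ω) = 1 := congrArg Subtype.val hy
    have hy0 : (y : Ω) ≠ 0 := right_ne_zero_of_mul (hy' ▸ one_ne_zero)
    have h1 := hv.map_mul x y hx0 hy0
    rw [hy', hv.map_one] at h1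
    have := (hv.mem_valSubring.1 y.2).resolve_left hy0
    have := hgt.resolve_left hx0
    linarith

lemma IsCDV.res_eq_iff {x y : Ω} (hx : Ge v 0 x) (hy : Ge v 0 y) :
    hv.res x = hv.res y ↔ Gt v 0 (x - y) := by
  rw [← sub_eq_zero, ← hv.res_sub hx hy, hv.res_eq_zero_iff (hv.ge_sub hx hy)]

/-- The ring of integers of `K`. -/
def IsCDV.intK : Subring K := hv.valSubring.toSubring.comap (algebraMap K Ω)

lemma IsCDV.mem_intK {c : K} : c ∈ hv.intK ↔ Ge v 0 (algebraMap K Ω c) := Iff.rfl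

omit hv in
lemma isIntK_iff {c : K} : IsIntK v K c ↔ Ge v 0 (algebraMap K Ω c) := by
  simp [IsIntK, Ge]

/-- The inclusion of the integers of `K` in `Ω`. -/
def IsCDV.intMap : hv.intK →+* Ω := (algebraMap K Ω).comp hv.intK.subtype

lemma IsCDV.ge_intMap (c : hv.intK) : Ge v 0 (hv.intMap c) := c.2

lemma IsCDV.ge_eval₂ (P : hv.intK[X]) {x : Ω} (hx : Ge v 0 x) : Ge v 0 (P.eval₂ hv.intMap x) := by
  rw [eval₂_eq_sum_range]
  exact hv.ge_sum _ _ fun i _ => hv.ge_zero_mul (hv.ge_intMap _)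
    (by simpa using hv.ge_pow hx i)

variable {k : Type} [Field k] {ρ : K → k} (hρ : IsResidueMap v K ρ)
include hρ

/-- The reduction map of `K` as a ring homomorphism. -/
def IsCDV.redK : hv.intK →+* k where
  toFun c := ρ c
  map_one' := hρ.2.2.1
  map_mul' x y := hρ.2.1 x y (isIntK_iff.2 x.2) (isIntK_iff.2 y.2)
  map_zero' := (hρ.2.2.2.2 0 (Or.inl rfl)).2 (Or.inl rfl)
  map_add' x y := hρ.1 x y (isIntK_iff.2 x.2) (isIntK_iff.2 y.2)

lemma IsCDV.redK_surjective : Function.Surjective (hv.redK hρ) := fun a => by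
  obtain ⟨x, hx, hxa⟩ := hρ.2.2.2.1 a
  exact ⟨⟨x, isIntK_iff.1 hx⟩, hxa⟩

/-- The embedding of the residue field of `K` into that of `Ω`. -/
lemma IsCDV.exists_residue_embedding :
    ∃ ι : k →+* hv.Res, ∀ c : hv.intK, ι (hv.redK hρ c) = hv.res (hv.intMap c) := by
  let g : hv.intK →+* hv.Res := (IsLocalRing.residue hv.valSubring).comp
    (hv.intMap.codRestrict hv.valSubring fun c => hv.ge_intMap c)
  have hg : ∀ c, g c = hv.res (hv.intMap c) := fun c => (hv.res_of_ge (hv.ge_intMap c)).symm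
  have hker : RingHom.ker (hv.redK hρ) ≤ RingHom.ker g := by
    intro c hc
    rw [RingHom.mem_ker] at hc ⊢
    rw [hg, hv.res_eq_zero_iff (hv.ge_intMap c)]
    rcases (hρ.2.2.2.2 c (isIntK_iff.2 c.2)).1 hc with h | h
    · exact Or.inl (by simp [IsCDV.intMap, h])
    · exact Or.inr h
  refine ⟨RingHom.liftOfRightInverse (hv.redK hρ) _
    (Function.rightInverse_surjInv (hv.redK_surjective hρ)) ⟨g, hker⟩, fun c => ?_⟩
  rw [RingHom.liftOfRightInverse_comp_apply]; exact hg c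

end Residue

section Galois

variable {K Ω : Type} [Field K] [Field Ω] [Algebra K Ω] {v : Ω → ℝ} (hv : IsCDV K Ω v)
  (L : IntermediateField K Ω)
include hv

lemma IsCDV.ge_galois {r : ℝ} {y : L} (σ : L ≃ₐ[K] L) (hy : Ge v r (y : Ω)) :
    Ge v r (σ y : Ω) := by
  rcases hy with h | h
  · exact Or.inl (by simp [(by exact_mod_cast h : y = 0)])
  · exact Or.inr (by rwa [hv.galois_inv])

variable [FiniteDimensional K ↥L] [IsGalois K ↥L]

/-- The characteristic polynomial of an integer of `L` has integral coefficients. -/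
lemma IsCDV.exists_map_eq_prod {y : L} (hy : Ge v 0 (y : Ω)) :
    ∃ P : hv.intK[X], P.Monic ∧ P.natDegree = Fintype.card (L ≃ₐ[K] L) ∧
      P.map hv.intMap = ∏ σ : L ≃ₐ[K] L, (X - C ((σ y : L) : Ω)) := by
  set Q : Polynomial Ω := ∏ σ : L ≃ₐ[K] L, (X - C ((σ y : L) : Ω)) with hQ
  have hQm : Q.Monic := monic_prod_of_monic _ _ fun σ _ => monic_X_sub_C _
  have hQd : Q.natDegree = Fintype.card (L ≃ₐ[K] L) := by
    rw [natDegree_prod_of_monic _ _ fun σ _ => monic_X_sub_C _]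
    simp only [natDegree_X_sub_C, Finset.sum_const, Finset.card_univ, smul_eq_mul, mul_one]
  have hlift : Q ∈ lifts hv.intMap := by
    rw [lifts_iff_coeff_lifts]
    intro i
    have hge : Ge v 0 (Q.coeff i) := by
      have : Q = (∏ σ : L ≃ₐ[K] L, (X - C (⟨(σ y : L), hv.ge_galois L σ hy⟩ : hv.valSubring))).map
          hv.valSubring.subtype := by
        rw [Polynomial.map_prod]; simp [hQ]
      rw [this, coeff_map]
      exact hv.mem_valSubring.1 (Subtype.property _)
    set R : L[X] := ∏ σ : L ≃ₐ[K] L, (X - C (σ y)) with hR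
    have hRQ : R.map (algebraMap L Ω) = Q := by
      rw [hR, Polynomial.map_prod]; simp [hQ]
    have hRfix : ∀ τ : L ≃ₐ[K] L, R.map (τ : L →+* L) = R := by
      intro τ
      rw [hR, Polynomial.map_prod]
      refine Fintype.prod_equiv (Equiv.mulLeft τ) _ _ fun σ => ?_
      simp
    obtain ⟨c, hc⟩ : R.coeff i ∈ Set.range (algebraMap K L) := by
      rw [IsGalois.mem_range_algebraMap_iff_fixed]
      intro τ
      conv_rhs => rw [← hRfix τ, coeff_map]
      rfl
    have hcQ : algebraMap K Ω c = Q.coeff i := by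
      rw [← hRQ, coeff_map, ← hc]; rfl
    exact ⟨⟨c, by rw [hv.mem_intK, hcQ]; exact hge⟩, hcQ⟩
  obtain ⟨P, hP, hPd, hPm⟩ := lifts_and_natDegree_eq_and_monic hlift hQm
  exact ⟨P, hPm, hPd.trans hQd, hP⟩

end Galois

section Values

variable {K Ω : Type} [Field K] [Field Ω] [Algebra K Ω] {v : Ω → ℝ} (hv : IsCDV K Ω v)
include hv

lemma IsCDV.map_div {x y : Ω} (hx : x ≠ 0) (hy : y ≠ 0) : v (x / y) = v x - v y := by
  rw [div_eq_mul_inv, hv.map_mul _ _ hx (inv_ne_zero hy), hv.map_inv hy, sub_eq_add_neg]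

lemma IsCDV.map_zpow {x : Ω} (hx : x ≠ 0) (z : ℤ) : v (x ^ z) = z * v x := by
  cases z with
  | ofNat n => simpa using hv.map_pow hx n
  | negSucc n =>
    rw [zpow_negSucc, hv.map_inv (pow_ne_zero _ hx), hv.map_pow hx]; push_cast; ring

variable (L : IntermediateField K Ω) [FiniteDimensional K ↥L] [IsGalois K ↥L]

lemma IsCDV.map_norm {y : L} (hy : y ≠ 0) :
    v (algebraMap K Ω (Algebra.norm K y)) = Fintype.card (L ≃ₐ[K] L) * v (y : Ω) := by
  have h : algebraMap K Ω (Algebra.norm K y) = ∏ σ : L ≃ₐ[K] L, ((σ y : L) : Ω) := by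
    have := congrArg (algebraMap L Ω) (Algebra.norm_eq_prod_automorphisms K y)
    rw [_root_.map_prod] at this
    exact this
  rw [h, hv.map_prod _ _ fun σ _ => by simpa using hy]
  simp [hv.galois_inv]

/-- The value group of `L` is generated by the value of some `π`, which is `1 / e` with
`e ≤ [L : K]`. -/
lemma IsCDV.exists_generator {t : K} (ht0 : t ≠ 0) (ht : v (algebraMap K Ω t) = 1) :
    ∃ (π : L) (e : ℕ), π ≠ 0 ∧ e * v (π : Ω) = 1 ∧ 0 < v (π : Ω) ∧
      e ≤ Fintype.card (L ≃ₐ[K] L) ∧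
      ∀ y : L, y ≠ 0 → ∃ z : ℤ, v (y : Ω) = z * v (π : Ω) := by
  classical
  set n := Fintype.card (L ≃ₐ[K] L)
  have hn : 0 < n := Fintype.card_pos
  have hn' : (0 : ℝ) < n := by exact_mod_cast hn
  have hint : ∀ y : L, y ≠ 0 → ∃ z : ℤ, n * v (y : Ω) = z := fun y hy => by
    rw [← hv.map_norm L hy]
    exact hv.int_valued _ (Algebra.norm_ne_zero_iff.2 hy)
  have htL : (algebraMap K L t) ≠ 0 := by simpa using ht0
  have htv : v ((algebraMap K L t : L) : Ω) = 1 := ht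
  have hex : ∃ N : ℕ, 0 < N ∧ ∃ y : L, y ≠ 0 ∧ n * v (y : Ω) = N :=
    ⟨n, hn, algebraMap K L t, htL, by rw [htv, mul_one]⟩
  obtain ⟨hN, π, hπ, hπv⟩ := Nat.find_spec hex
  have hmin := fun N => Nat.find_min (m := N) hex
  set N := Nat.find hex
  have hN' : (0 : ℝ) < N := by exact_mod_cast hN
  have hπΩ : (π : Ω) ≠ 0 := by simpa using hπ
  have hπpos : 0 < v (π : Ω) := by
    by_contra h; push Not at h; nlinarith
  have hgen : ∀ y : L, y ≠ 0 → ∃ z : ℤ, v (y : Ω) = z * v (π : Ω) := by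
    intro y hy
    have hyΩ : (y : Ω) ≠ 0 := by simpa using hy
    obtain ⟨z, hz⟩ := hint y hy
    refine ⟨z / N, ?_⟩
    have hr0 : 0 ≤ z % N := Int.emod_nonneg _ (by omega)
    have hrN : z % N < N := Int.emod_lt_of_pos _ (by omega)
    have hval : n * v ((y / π ^ (z / N : ℤ) : L) : Ω) = (z % N : ℤ) := by
      rw [IntermediateField.coe_div, hv.map_div hyΩ (by simpa using zpow_ne_zero _ hπ)]
      have : ((π ^ (z / N : ℤ) : L) : Ω) = (π : Ω) ^ (z / N : ℤ) := map_zpow₀ L.val π _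
      rw [this, hv.map_zpow hπΩ, mul_sub, hz]
      have h1 : (z : ℝ) = (z % N : ℤ) + N * (z / N : ℤ) := by
        exact_mod_cast (Int.emod_add_mul_ediv z N).symm
      linear_combination h1 - ((z / N : ℤ) : ℝ) * hπv
    have hr : z % N = 0 := by
      by_contra hne
      refine hmin (z % N).toNat (by omega) ⟨by omega, y / π ^ (z / N : ℤ),
        div_ne_zero hy (zpow_ne_zero _ hπ), ?_⟩
      rw [hval]
      have : ((z % N).toNat : ℤ) = z % N := Int.toNat_of_nonneg hr0
      exact_mod_cast this.symm
    have h1 : (z : ℝ) = N * (z / N : ℤ) := by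
      have := Int.emod_add_mul_ediv z N
      rw [hr, zero_add] at this
      exact_mod_cast this.symm
    refine mul_left_cancel₀ hn'.ne' ?_
    rw [hz, h1]; linear_combination (-((z / N : ℤ) : ℝ)) * hπv
  obtain ⟨q, hq⟩ := hgen _ htL
  rw [htv] at hq
  have hqpos : 0 < q := by
    have : (0 : ℝ) < q := by
      by_contra h; push Not at h; nlinarith
    exact_mod_cast this
  have hqe : ((q.toNat : ℕ) : ℝ) = q := by exact_mod_cast Int.toNat_of_nonneg hqpos.le
  refine ⟨π, q.toNat, hπ, by rw [hqe, ← hq], hπpos, ?_, hgen⟩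
  have h1 : (n : ℝ) = N * q.toNat := by
    rw [hqe]; linear_combination (-(q : ℝ)) * (-hπv) + (n : ℝ) * hq
  have h2 : n = N * q.toNat := by exact_mod_cast h1
  rw [h2]; exact Nat.le_mul_of_pos_left _ hN

/-- If the Galois group acts trivially on the residue field of `L`, and the residue field of `K`
is perfect, then `L / K` has trivial residue extension. -/
lemma IsCDV.exists_residue_lift {k : Type} [Field k] [PerfectField k] {ρ : K → k}
    (hρ : IsResidueMap v K ρ)
    (hG : ∀ (σ : L ≃ₐ[K] L) (y : L), Ge v 0 (y : Ω) → Gt v 0 ((σ y : Ω) - y))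
    {y : L} (hy : Ge v 0 (y : Ω)) :
    ∃ c : hv.intK, Gt v 0 ((y : Ω) - hv.intMap c) := by
  obtain ⟨ι, hι⟩ := hv.exists_residue_embedding hρ
  obtain ⟨P, hPm, hPd, hP⟩ := hv.exists_map_eq_prod L hy
  let _ : Algebra k hv.Res := ι.toAlgebra
  have hσ : ∀ σ : L ≃ₐ[K] L, hv.res ((σ y : L) : Ω) = hv.res y := fun σ =>
    (hv.res_eq_iff (hv.ge_galois L σ hy) hy).2 (hG σ y hy)
  let φ : hv.valSubring →+* hv.Res := IsLocalRing.residue hv.valSubring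
  let j : hv.intK →+* hv.valSubring := hv.intMap.codRestrict hv.valSubring fun c => hv.ge_intMap c
  have hPj : P.map j =
      ∏ σ : L ≃ₐ[K] L, (X - C (⟨(σ y : L), hv.ge_galois L σ hy⟩ : hv.valSubring)) := by
    apply map_injective hv.valSubring.subtype Subtype.val_injective
    rw [Polynomial.map_map, Polynomial.map_prod]
    refine Eq.trans ?_ (hP.trans ?_)
    · rfl
    · simp
  have hPk : (P.map (hv.redK hρ)).map ι = (X - C (hv.res y)) ^ Fintype.card (L ≃ₐ[K] L) := by
    have h1 : (P.map j).map φ = (P.map (hv.redK hρ)).map ι := by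
      rw [Polynomial.map_map, Polynomial.map_map]
      congr 1
      ext c
      exact ((hι c).trans (hv.res_of_ge (hv.ge_intMap c))).symm
    rw [← h1, hPj, Polynomial.map_prod, ← Finset.card_univ]
    refine Finset.prod_eq_pow_card fun σ _ => ?_
    rw [Polynomial.map_sub, map_X, map_C, ← hσ σ, hv.res_of_ge (hv.ge_galois L σ hy)]
  have hn : Fintype.card (L ≃ₐ[K] L) ≠ 0 := Fintype.card_ne_zero
  have haev : aeval (hv.res y) (P.map (hv.redK hρ)) = 0 := by
    rw [aeval_def, ← eval_map]
    change eval _ ((P.map (hv.redK hρ)).map ι) = 0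
    rw [hPk]; simp [hn]
  have hint : IsIntegral k (hv.res y) := ⟨_, hPm.map _, haev⟩
  have hdvd : (minpoly k (hv.res y)).map (algebraMap k hv.Res) ∣
      (X - C (hv.res y)) ^ Fintype.card (L ≃ₐ[K] L) := by
    rw [← hPk]; exact Polynomial.map_dvd _ (minpoly.dvd k _ haev)
  have hsep : ((minpoly k (hv.res y)).map (algebraMap k hv.Res)).Separable :=
    (PerfectField.separable_of_irreducible (minpoly.irreducible hint)).map
  obtain ⟨i, -, hi⟩ := (dvd_prime_pow (prime_X_sub_C (hv.res y)) _).1 hdvd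
  have hi1 : i ≤ 1 := by
    by_contra! h
    have hsq := hsep.squarefree (X - C (hv.res y)) ((by
      rw [← sq]; exact pow_dvd_pow _ h : _ ∣ (X - C (hv.res y)) ^ i).trans hi.symm.dvd)
    exact not_isUnit_X_sub_C _ hsq
  have hdeg : (minpoly k (hv.res y)).natDegree = 1 := by
    have h1 := natDegree_eq_of_degree_eq (degree_eq_degree_of_associated hi)
    rw [natDegree_map, natDegree_pow, natDegree_X_sub_C, mul_one] at h1
    have := minpoly.natDegree_pos hint
    omega
  obtain ⟨a, ha⟩ := minpoly.natDegree_eq_one_iff.1 hdeg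
  obtain ⟨c, hc⟩ := hv.redK_surjective hρ a
  refine ⟨c, (hv.res_eq_iff hy (hv.ge_intMap c)).1 ?_⟩
  rw [← hι, hc]; exact ha.symm

end Values

section Monogenic

variable {K Ω : Type} [Field K] [Field Ω] [Algebra K Ω] {v : Ω → ℝ} (hv : IsCDV K Ω v)
  (L : IntermediateField K Ω) [FiniteDimensional K ↥L] [IsGalois K ↥L]
  {t : K} (ht0 : t ≠ 0) (ht : v (algebraMap K Ω t) = 1)
include hv ht0 ht

omit [IsGalois K ↥L] [FiniteDimensional K ↥L] in
lemma IsCDV.exists_pow_mul_ge (y : L) (r : ℝ) :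
    ∃ N : ℕ, Ge v r ((algebraMap K L t ^ N * y : L) : Ω) := by
  rcases eq_or_ne y 0 with rfl | hy
  · exact ⟨0, Or.inl (by simp)⟩
  obtain ⟨N, hN⟩ := exists_nat_ge (r - v (y : Ω))
  refine ⟨N, Or.inr ?_⟩
  have h : ((algebraMap K L t ^ N * y : L) : Ω) = algebraMap K Ω t ^ N * y := rfl
  have ht' : algebraMap K Ω t ≠ 0 := by simpa using ht0
  rw [h, hv.map_mul _ _ (pow_ne_zero _ ht') (by simpa using hy), hv.map_pow ht', ht]
  linarith

omit ht0 ht in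
/-- A `K`-linear form on `L` is bounded. -/
lemma IsCDV.exists_bound (f : L →ₗ[K] K) :
    ∃ B : ℝ, ∀ r : ℝ, ∀ y : L, Ge v r (y : Ω) → Ge v (B + r) (algebraMap K Ω (f y)) := by
  obtain ⟨d, hd⟩ := ((Algebra.traceForm K L).toDual (traceForm_nondegenerate K L)).surjective f
  obtain ⟨B, hB⟩ : ∃ B, Ge v B (d : Ω) := ⟨v d, Or.inr le_rfl⟩
  refine ⟨B, fun r y hy => ?_⟩
  have h1 : f y = Algebra.trace K L (d * y) := by
    rw [← hd, LinearMap.BilinForm.toDual_def, Algebra.traceForm_apply]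
  have h2 : algebraMap K Ω (f y) = ∑ σ : L ≃ₐ[K] L, ((σ (d * y) : L) : Ω) := by
    have := congrArg (algebraMap L Ω) (trace_eq_sum_automorphisms (K := K) (d * y))
    rw [_root_.map_sum] at this
    rw [h1]; exact this
  rw [h2]
  exact hv.ge_sum _ _ fun σ _ => hv.ge_galois L σ (hv.ge_mul hB hy)

/-- If `L / K` has trivial residue extension, it is generated by an element of valuation
`1 / [L : K]`, whose powers form a basis. -/
lemma IsCDV.exists_uniformizer_span
    (hres : ∀ y : L, Ge v 0 (y : Ω) → ∃ c : hv.intK, Gt v 0 ((y : Ω) - hv.intMap c)) :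
    ∃ π : L, π ≠ 0 ∧ Fintype.card (L ≃ₐ[K] L) * v (π : Ω) = 1 ∧
      (∀ y : L, y ≠ 0 → ∃ z : ℤ, v (y : Ω) = z * v (π : Ω)) ∧
      ∀ y : L, ∃ c : ℕ → K,
        y = ∑ j ∈ Finset.range (Fintype.card (L ≃ₐ[K] L)), c j • π ^ j := by
  obtain ⟨π, e, hπ, he, hpos, hle, hgen⟩ := hv.exists_generator L ht0 ht
  have hπΩ : (π : Ω) ≠ 0 := by simpa using hπ
  have htΩ : algebraMap K Ω t ≠ 0 := by simpa using ht0
  have he0 : 0 < e := by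
    rcases Nat.eq_zero_or_pos e with rfl | h
    · simp at he
    · exact h
  set b : Fin e → L := fun j => π ^ (j : ℕ)
  set V := Submodule.span K (Set.range b)
  have happrox : ∀ y : L, Ge v 0 (y : Ω) → ∀ N : ℕ,
      ∃ u ∈ V, Ge v (N * v (π : Ω)) ((y - u : L) : Ω) := by
    intro y hy N
    induction N with
    | zero => exact ⟨0, zero_mem V, by simpa using hy⟩
    | succ N ih =>
      obtain ⟨u, hu, huy⟩ := ih
      rcases eq_or_ne (y - u) 0 with h0 | h0
      · exact ⟨u, hu, Or.inl (by simp [h0])⟩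
      have h0Ω : ((y - u : L) : Ω) ≠ 0 := ZeroMemClass.coe_eq_zero.not.2 h0
      set d : L := t ^ (N / e) • π ^ (N % e) with hd
      have hdΩ : (d : Ω) = algebraMap K Ω t ^ (N / e) * (π : Ω) ^ (N % e) := by
        rw [hd, Algebra.smul_def, _root_.map_pow]; rfl
      have hd0 : (d : Ω) ≠ 0 := hdΩ ▸ mul_ne_zero (pow_ne_zero _ htΩ) (pow_ne_zero _ hπΩ)
      have hdv : v (d : Ω) = N * v (π : Ω) := by
        rw [hdΩ, hv.map_mul _ _ (pow_ne_zero _ htΩ) (pow_ne_zero _ hπΩ), hv.map_pow htΩ,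
          hv.map_pow hπΩ, ht]
        have : (N : ℝ) = (N % e : ℕ) + e * (N / e : ℕ) := by
          exact_mod_cast (Nat.mod_add_div N e).symm
        rw [this]; linear_combination (-((N / e : ℕ) : ℝ)) * he
      have hdV : d ∈ V := V.smul_mem _ (Submodule.subset_span ⟨⟨N % e, Nat.mod_lt _ he0⟩, rfl⟩)
      have hq : Ge v 0 (((y - u) / d : L) : Ω) := by
        refine Or.inr ?_
        rw [IntermediateField.coe_div, hv.map_div h0Ω hd0, hdv]
        have := huy.resolve_left h0Ω
        linarith
      obtain ⟨c, hc⟩ := hres _ hq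
      refine ⟨u + (c : K) • d, V.add_mem hu (V.smul_mem _ hdV), ?_⟩
      have heq : ((y - (u + (c : K) • d) : L) : Ω) =
          ((((y - u) / d : L) : Ω) - hv.intMap c) * (d : Ω) := by
        have : hv.intMap c = ((algebraMap K L c : L) : Ω) := rfl
        rw [this, Algebra.smul_def, sub_mul]
        push_cast
        field_simp
        ring
      have hgt : Gt v (N * v (π : Ω)) ((y - (u + (c : K) • d) : L) : Ω) := by
        rw [heq]
        simpa using hv.gt_mul hc (Or.inr hdv.ge : Ge v (N * v (π : Ω)) (d : Ω))
      rcases eq_or_ne (y - (u + (c : K) • d)) 0 with h1 | h1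
      · exact Or.inl (by rw [h1]; rfl)
      obtain ⟨z, hz⟩ := hgen _ h1
      have h2 := hgt.resolve_left (ZeroMemClass.coe_eq_zero.not.2 h1)
      refine Or.inr ?_
      rw [hz] at h2 ⊢
      have h3 : (N : ℝ) < z := lt_of_mul_lt_mul_right h2 hpos.le
      have h4 : (N : ℤ) < z := by exact_mod_cast h3
      have h5 : ((N + 1 : ℕ) : ℝ) ≤ z := by exact_mod_cast h4
      exact mul_le_mul_of_nonneg_right h5 hpos.le
  have hV : V = ⊤ := by
    by_contra hne
    obtain ⟨f, hf, hfV⟩ := V.exists_le_ker_of_lt_top (lt_top_iff_ne_top.2 hne)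
    obtain ⟨B, hB⟩ := hv.exists_bound L f
    have hint : ∀ y : L, Ge v 0 (y : Ω) → f y = 0 := by
      intro y hy
      by_contra h0
      have h0' : algebraMap K Ω (f y) ≠ 0 := by simpa using h0
      obtain ⟨N, hN⟩ := exists_nat_gt ((v (algebraMap K Ω (f y)) - B) / v (π : Ω))
      obtain ⟨u, hu, huy⟩ := happrox y hy N
      have h1 := hB _ _ huy
      rw [_root_.map_sub, LinearMap.mem_ker.1 (hfV hu), sub_zero] at h1
      have h2 := h1.resolve_left h0'
      rw [div_lt_iff₀ hpos] at hN
      linarith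
    apply hf
    ext y
    obtain ⟨N, hN⟩ := hv.exists_pow_mul_ge L ht0 ht y 0
    have h1 := hint _ hN
    rw [← _root_.map_pow, ← Algebra.smul_def, map_smul, smul_eq_mul] at h1
    simpa using (mul_eq_zero.1 h1).resolve_left (pow_ne_zero N ht0)
  have hcard : Fintype.card (L ≃ₐ[K] L) = Module.finrank K L := by
    rw [← Nat.card_eq_fintype_card, IsGalois.card_aut_eq_finrank]
  have hen : e = Fintype.card (L ≃ₐ[K] L) := by
    refine le_antisymm hle ?_
    rw [hcard, ← finrank_top, ← hV]
    exact (finrank_range_le_card b).trans (by simp)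
  refine ⟨π, hπ, hen ▸ he, hgen, fun y => ?_⟩
  rw [← hen]
  have hy : y ∈ V := hV ▸ Submodule.mem_top
  obtain ⟨c, hc⟩ := (Submodule.mem_span_range_iff_exists_fun K).1 hy
  refine ⟨fun j => if h : j < e then c ⟨j, h⟩ else 0, ?_⟩
  rw [← hc, Finset.sum_range]
  simp [b]

end Monogenic

/-- The conditions of `IsHomMod` over the base field `K`, for the ideal `v ≥ M`. -/
def IsHomGe {K Ω : Type} [Field K] [Field Ω] [Algebra K Ω] (v : Ω → ℝ)
    (L E : IntermediateField K Ω) (M : ℝ) (f : Ω → Ω) : Prop :=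
  (∀ x, IsInt v L x → IsInt v E (f x)) ∧
  (∀ x y, IsInt v L x → IsInt v L y → Ge v M (f (x + y) - (f x + f y))) ∧
  (∀ x y, IsInt v L x → IsInt v L y → Ge v M (f (x * y) - f x * f y)) ∧
  Ge v M (f 1 - 1) ∧
  (∀ c, IsInt v (⊥ : IntermediateField K Ω) c → Ge v M (f c - c))

section Eisenstein

variable {K Ω : Type} [Field K] [Field Ω] [Algebra K Ω] {v : Ω → ℝ} (hv : IsCDV K Ω v)
include hv

lemma IsCDV.eval₂_eq_sum (P : hv.intK[X]) {n : ℕ} (hP : P.natDegree < n) (x : Ω) :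
    P.eval₂ hv.intMap x = ∑ j ∈ Finset.range n, algebraMap K Ω (P.coeff j : K) * x ^ j :=
  eval₂_eq_sum_range' _ hP x

/-- Two polynomial expressions in `π` agreeing at `π` agree at `x` modulo the value at `x` of a
polynomial `F` vanishing at `π`, of degree `n` with `v π = 1 / n`. -/
lemma IsCDV.ge_eval₂_of_eval₂_eq_zero {n : ℕ} {π : Ω} (hπ : π ≠ 0) (hπn : n * v π = 1)
    {F : hv.intK[X]} (hF : F.Monic) (hFn : F.natDegree = n) (hFπ : F.eval₂ hv.intMap π = 0)
    {x : Ω} (hx : Ge v 0 x) {M : ℝ} (hFx : Ge v M (F.eval₂ hv.intMap x))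
    {P : hv.intK[X]} (hP : P.eval₂ hv.intMap π = 0) : Ge v M (P.eval₂ hv.intMap x) := by
  have hn : n ≠ 0 := by rintro rfl; simp at hπn
  have hF1 : F ≠ 1 := by rintro rfl; exact hn (by rw [← hFn, natDegree_one])
  have hdiv := modByMonic_add_div P F
  have hR : P %ₘ F = 0 := by
    have hdeg : (P %ₘ F).natDegree < n := hFn ▸ natDegree_modByMonic_lt P hF hF1
    have h0 : (P %ₘ F).eval₂ hv.intMap π = 0 := by
      have := congrArg (eval₂ hv.intMap π) hdiv
      rwa [eval₂_add, eval₂_mul, hFπ, zero_mul, add_zero, hP] at this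
    rw [hv.eval₂_eq_sum _ hdeg] at h0
    have hc := hv.coeff_eq_zero_of_sum_eq_zero hπ hπn _ h0
    ext j
    rcases lt_or_ge j n with h | h
    · simpa using hc j h
    · rw [coeff_eq_zero_of_natDegree_lt (hdeg.trans_le h), coeff_zero]
  rw [← hdiv, hR, zero_add, eval₂_mul]
  simpa using hv.ge_mul hFx (hv.ge_eval₂ (P /ₘ F) hx)

lemma IsCDV.exists_isHomGe {n : ℕ} {L E : IntermediateField K Ω} {π : Ω} (hπ : π ≠ 0)
    (hπn : n * v π = 1)
    (hrep : ∀ y, IsInt v L y → ∃ P : hv.intK[X], P.eval₂ hv.intMap π = y)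
    {F : hv.intK[X]} (hF : F.Monic) (hFn : F.natDegree = n) (hFπ : F.eval₂ hv.intMap π = 0)
    {x : Ω} (hxE : x ∈ E) (hx : Ge v 0 x) {M : ℝ} (hFx : Ge v M (F.eval₂ hv.intMap x)) :
    ∃ f : Ω → Ω, IsHomGe v L E M f := by
  choose! g hg using hrep
  have key := fun P => hv.ge_eval₂_of_eval₂_eq_zero hπ hπn hF hFn hFπ hx hFx (P := P)
  have h1 : IsInt v L 1 := ⟨one_mem L, hv.ge_one⟩
  have hbot : ∀ c, IsInt v (⊥ : IntermediateField K Ω) c → IsInt v L c :=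
    fun c hc => ⟨bot_le (a := L) hc.1, hc.2⟩
  refine ⟨fun y => (g y).eval₂ hv.intMap x, fun y _ => ⟨?_, hv.ge_eval₂ _ hx⟩,
    fun y z hy hz => ?_, fun y z hy hz => ?_, ?_, fun c hc => ?_⟩
  · change (g y).eval₂ hv.intMap x ∈ E
    rw [eval₂_eq_sum_range]
    exact sum_mem fun j _ => mul_mem (E.algebraMap_mem _) (pow_mem hxE j)
  · have hyz : IsInt v L (y + z) := ⟨add_mem hy.1 hz.1, hv.ge_add hy.2 hz.2⟩
    have := key (g (y + z) - (g y + g z))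
      (by simp [eval₂_sub, eval₂_add, hg _ hy, hg _ hz, hg _ hyz])
    simpa only [eval₂_sub, eval₂_add] using this
  · have hyz : IsInt v L (y * z) := ⟨mul_mem hy.1 hz.1, hv.ge_zero_mul hy.2 hz.2⟩
    have := key (g (y * z) - (g y * g z))
      (by simp [eval₂_sub, eval₂_mul, hg _ hy, hg _ hz, hg _ hyz])
    simpa only [eval₂_sub, eval₂_mul] using this
  · have := key (g 1 - 1) (by simp [eval₂_sub, hg _ h1])
    simpa only [eval₂_sub, eval₂_one] using this
  · obtain ⟨a, rfl⟩ := mem_bot.1 hc.1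
    let a' : hv.intK := ⟨a, hc.2⟩
    have ha' : hv.intMap a' = algebraMap K Ω a := rfl
    have := key (g (algebraMap K Ω a) - C a') (by
      rw [eval₂_sub, hg _ (hbot _ hc), eval₂_C, ha', sub_self])
    simpa only [eval₂_sub, eval₂_C, ha'] using this

omit hv in
lemma exists_sum_of_mem_adjoin {n : ℕ} {x : Ω} {g : K[X]} (hg : g.Monic) (hgn : g.natDegree = n)
    (hn : n ≠ 0) (hgx : aeval x g = 0) {y : Ω} (hy : y ∈ K⟮x⟯) :
    ∃ c : ℕ → K, y = ∑ j ∈ Finset.range n, algebraMap K Ω (c j) * x ^ j := by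
  have hint : IsIntegral K x := ⟨g, hg, hgx⟩
  rw [← mem_toSubalgebra, adjoin_simple_toSubalgebra_of_isAlgebraic hint.isAlgebraic,
    Algebra.adjoin_singleton_eq_range_aeval] at hy
  obtain ⟨Q, rfl⟩ := hy
  have hg1 : g ≠ 1 := by rintro rfl; exact hn (by rw [← hgn, natDegree_one])
  refine ⟨(Q %ₘ g).coeff, ?_⟩
  have h := congrArg (aeval x) (modByMonic_add_div Q g)
  rw [_root_.map_add, _root_.map_mul, hgx, zero_mul, add_zero] at h
  change aeval x Q = _
  rw [← h, aeval_def]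
  exact eval₂_eq_sum_range' _ (hgn ▸ natDegree_modByMonic_lt Q hg hg1) x

/-- `K(x) / K` is totally ramified if `x` has degree `n` and `v x = 1 / n`. -/
lemma IsCDV.totRam_adjoin {n : ℕ} {x : Ω} {g : K[X]} (hg : g.Monic) (hgn : g.natDegree = n)
    (hgx : aeval x g = 0) (hx0 : x ≠ 0) (hx : n * v x = 1) : TotRam v ⊥ K⟮x⟯ := by
  intro y hy
  obtain ⟨n, rfl⟩ : ∃ n', n = n' + 1 :=
    Nat.exists_eq_succ_of_ne_zero (by rintro rfl; simp at hx)
  obtain ⟨c, rfl⟩ := exists_sum_of_mem_adjoin hg hgn (by omega) hgx hy.1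
  have hc := hv.ge_coeff_of_ge_sum hx0 hx c hy.2
  have hpos : 0 < v x := by
    by_contra h; push Not at h; push_cast at hx; nlinarith [(Nat.cast_nonneg n : (0:ℝ) ≤ n)]
  refine ⟨algebraMap K Ω (c 0), mem_bot.2 ⟨_, rfl⟩, hc 0 (by omega), ?_⟩
  rw [Finset.sum_range_succ']
  simp only [pow_zero, mul_one, add_sub_cancel_right]
  refine hv.gt_sum _ _ fun j hj => ?_
  have h1 : Ge v (((j + 1 : ℕ) : ℝ) * v x) (x ^ (j + 1)) := hv.ge_pow (Or.inr le_rfl) _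
  have h2 := hv.ge_mul (hc (j + 1) (by rw [Finset.mem_range] at hj; omega)) h1
  exact h2.gt (by rw [zero_add]; positivity)

lemma IsCDV.map_eq_of_gt_sub {x y : Ω} (hy : y ≠ 0) (h : Gt v (v y) (x - y)) :
    x ≠ 0 ∧ v x = v y := by
  have hx : x ≠ 0 := by
    rintro rfl
    rw [zero_sub] at h
    have := hv.gt_neg h
    rw [neg_neg] at this
    exact this.not_le hy le_rfl
  refine ⟨hx, le_antisymm ?_ ?_⟩
  · by_contra! hlt
    have := hv.gt_sub (Or.inr hlt : Gt v (v y) x) h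
    rw [sub_sub_cancel] at this
    exact this.not_le hy le_rfl
  · have := hv.ge_add h.ge (Or.inr le_rfl : Ge v (v y) y)
    rw [sub_add_cancel] at this
    exact this.resolve_left hx

lemma IsCDV.res_pow {x : Ω} (hx : Ge v 0 x) (n : ℕ) : hv.res (x ^ n) = hv.res x ^ n := by
  have := hv.res_prod (Finset.range n) (fun _ => x) fun _ => hx
  simpa using this

end Eisenstein

section Core

variable {K Ω : Type} [Field K] [Field Ω] [Algebra K Ω] {v : Ω → ℝ} (hv : IsCDV K Ω v)
include hv

lemma IsCDV.exists_ge_of_ge_prod {ι : Type*} [Fintype ι] [Nonempty ι] {f : ι → Ω} {r : ℝ}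
    (h : Ge v (Fintype.card ι * r) (∏ i, f i)) : ∃ i, Ge v r (f i) := by
  by_contra! hf
  have hf0 : ∀ i, f i ≠ 0 := fun i h0 => hf i (Or.inl h0)
  have hlt : ∀ i, v (f i) < r := fun i => not_le.1 fun hle => hf i (Or.inr hle)
  have h1 := h.resolve_left (Finset.prod_ne_zero_iff.2 fun i _ => hf0 i)
  rw [hv.map_prod _ _ fun i _ => hf0 i] at h1
  have h2 := Finset.sum_lt_sum_of_nonempty Finset.univ_nonempty fun i (_ : i ∈ Finset.univ) => hlt i
  simp only [Finset.sum_const, Finset.card_univ, nsmul_eq_mul] at h2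
  exact h1.not_gt h2

lemma IsCDV.sub_dvd_eval₂_sub (P : hv.intK[X]) {x y : Ω} (hx : Ge v 0 x) (hy : Ge v 0 y) :
    ∃ u, Ge v 0 u ∧ P.eval₂ hv.intMap x - P.eval₂ hv.intMap y = (x - y) * u := by
  let g : hv.intK →+* hv.valSubring := hv.intMap.codRestrict hv.valSubring fun c => hv.ge_intMap c
  have key : ∀ z : hv.valSubring, ((P.eval₂ g z : hv.valSubring) : Ω) = P.eval₂ hv.intMap z :=
    fun z => hom_eval₂ P g hv.valSubring.subtype z
  obtain ⟨u, hu⟩ := sub_dvd_eval_sub (⟨x, hx⟩ : hv.valSubring) ⟨y, hy⟩ (P.map g)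
  refine ⟨u, hv.mem_valSubring.1 u.2, ?_⟩
  rw [eval_map, eval_map] at hu
  have := congrArg (Subtype.val) hu
  rw [← key ⟨x, hx⟩, ← key ⟨y, hy⟩]
  exact this

variable {L : IntermediateField K Ω}

lemma IsCDV.exists_eval₂_eq {π : L} {n : ℕ} (hπ : π ≠ 0) (hπn : n * v (π : Ω) = 1)
    (hspan : ∀ y : L, ∃ c : ℕ → K, y = ∑ j ∈ Finset.range n, c j • π ^ j)
    {y : Ω} (hy : IsInt v L y) : ∃ P : hv.intK[X], P.eval₂ hv.intMap (π : Ω) = y := by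
  obtain ⟨c, hc⟩ := hspan ⟨y, hy.1⟩
  have hsum : y = ∑ j ∈ Finset.range n, algebraMap K Ω (c j) * (π : Ω) ^ j := by
    have := congrArg (algebraMap L Ω) hc
    simp only [_root_.map_sum, Algebra.smul_def, _root_.map_mul, _root_.map_pow] at this
    exact this
  have hge := hv.ge_coeff_of_ge_sum (ZeroMemClass.coe_eq_zero.not.2 hπ) hπn c (hsum ▸ hy.2)
  refine ⟨∑ j ∈ Finset.range n, if h : j < n then C ⟨c j, hge j h⟩ * X ^ j else 0, ?_⟩
  rw [hsum, eval₂_finsetSum]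
  refine Finset.sum_congr rfl fun j hj => ?_
  rw [dif_pos (Finset.mem_range.1 hj), eval₂_mul, eval₂_C, eval₂_X_pow]
  rfl

/-- If `π` generates the integers of `L`, then `v (σ π - π)` is the minimum of the
`v (σ y - y)`. -/
lemma IsCDV.map_galois_sub {π : L} (hπ : Ge v 0 (π : Ω))
    (hrep : ∀ y, IsInt v L y → ∃ P : hv.intK[X], P.eval₂ hv.intMap (π : Ω) = y)
    {σ : L ≃ₐ[K] L} {δ : ℝ} (hlow : ∀ y : L, Ge v 0 (y : Ω) → Ge v δ ((σ y : Ω) - y))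
    (hup : ∀ r, (∀ y : L, Ge v 0 (y : Ω) → Ge v r ((σ y : Ω) - y)) → r ≤ δ) :
    (σ π : Ω) - π ≠ 0 ∧ v ((σ π : Ω) - π) = δ := by
  have hdvd : ∀ y : L, Ge v 0 (y : Ω) → ∃ u, Ge v 0 u ∧ (σ y : Ω) - y = ((σ π : Ω) - π) * u := by
    intro y hy
    obtain ⟨P, hP⟩ := hrep y ⟨y.2, hy⟩
    have hL : y = P.eval₂ ((algebraMap K L).comp hv.intK.subtype) π := by
      apply Subtype.ext
      rw [← hP]
      exact (hom_eval₂ P ((algebraMap K L).comp hv.intK.subtype) (algebraMap L Ω) π).symm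
    have hσ : (σ y : Ω) = P.eval₂ hv.intMap (σ π : Ω) := by
      have h1 : σ y = P.eval₂ ((algebraMap K L).comp hv.intK.subtype) (σ π) := by
        conv_lhs => rw [hL]
        rw [← AlgEquiv.coe_ringEquiv, ← RingEquiv.coe_toRingHom, hom_eval₂]
        congr 1
        ext c
        simp
      rw [h1]
      exact hom_eval₂ P ((algebraMap K L).comp hv.intK.subtype) (algebraMap L Ω) (σ π)
    obtain ⟨u, hu, h⟩ := hv.sub_dvd_eval₂_sub P (hv.ge_galois L σ hπ) hπ
    exact ⟨u, hu, by rw [hσ, ← h, hP]⟩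
  have hne : (σ π : Ω) - π ≠ 0 := by
    intro h0
    have := hup (δ + 1) fun y hy => by
      obtain ⟨u, -, h⟩ := hdvd y hy
      rw [h, h0, zero_mul]
      exact Ge.zero
    linarith
  refine ⟨hne, le_antisymm (hup _ fun y hy => ?_) ((hlow π hπ).resolve_left hne)⟩
  obtain ⟨u, hu, h⟩ := hdvd y hy
  rw [h]
  simpa using hv.ge_mul (Or.inr le_rfl : Ge v _ ((σ π : Ω) - π)) hu

omit hv in
lemma totRam_bot : TotRam v (⊥ : IntermediateField K Ω) ⊥ :=
  fun x hx => ⟨x, hx.1, hx.2, Or.inl (sub_self x)⟩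

variable [FiniteDimensional K ↥L] [IsGalois K ↥L]

/-- Krasner-type step: perturbing the constant coefficient of the minimal polynomial of `π` yields
elements of `L`. -/
lemma IsCDV.exists_prod_sub_eq [IsAlgClosed Ω] {π : L} {δ : ℝ}
    (hπ : π ≠ 0) (hπn : Fintype.card (L ≃ₐ[K] L) * v (π : Ω) = 1)
    (hrep : ∀ y, IsInt v L y → ∃ P : hv.intK[X], P.eval₂ hv.intMap (π : Ω) = y)
    (hlow : ∀ σ : L ≃ₐ[K] L, Ge v δ ((σ π : Ω) - π))
    (hδ : v (π : Ω) < δ)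
    (hP : ∀ E : IntermediateField K Ω, TotRam v ⊥ E →
      (∃ f, IsHomGe v L E (Fintype.card (L ≃ₐ[K] L) * δ) f) → L ≤ E)
    {b : hv.intK} (hb : Ge v (Fintype.card (L ≃ₐ[K] L) * δ) (hv.intMap b)) :
    ∃ x : L, Ge v δ ((x : Ω) - π) ∧ ∏ σ : L ≃ₐ[K] L, ((x : Ω) - (σ π : L)) = - hv.intMap b := by
  set n := Fintype.card (L ≃ₐ[K] L) with hn
  have hn0 : n ≠ 0 := Fintype.card_ne_zero
  have hπΩ : (π : Ω) ≠ 0 := ZeroMemClass.coe_eq_zero.not.2 hπ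
  have hvπ : 0 < v (π : Ω) := by
    by_contra h; push Not at h; nlinarith [(Nat.cast_nonneg n : (0:ℝ) ≤ n)]
  have hπge : Ge v 0 (π : Ω) := Or.inr hvπ.le
  obtain ⟨F, hF, hFn, hFprod⟩ := hv.exists_map_eq_prod L hπge
  rw [← hn] at hFn
  have hFeval : ∀ x, F.eval₂ hv.intMap x = ∏ σ : L ≃ₐ[K] L, (x - (σ π : L)) := fun x => by
    rw [← eval_map, hFprod, eval_prod]; simp
  have hFπ : F.eval₂ hv.intMap (π : Ω) = 0 := by
    rw [hFeval]
    exact Finset.prod_eq_zero (Finset.mem_univ 1) (by simp)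
  have hGm : (F + C b).Monic := hF.add_of_left (degree_C_le.trans_lt (by
    rw [degree_eq_natDegree hF.ne_zero, hFn]; exact_mod_cast Nat.pos_of_ne_zero hn0))
  have hGn : (F + C b).natDegree = n := by rw [natDegree_add_C, hFn]
  obtain ⟨x, hx⟩ := IsAlgClosed.exists_root ((F + C b).map hv.intMap) (by
    rw [degree_eq_natDegree (hGm.map _).ne_zero, hGm.natDegree_map, hGn]; exact_mod_cast hn0)
  rw [IsRoot.def, eval_map, eval₂_add, eval₂_C] at hx
  have hFx : F.eval₂ hv.intMap x = - hv.intMap b := eq_neg_of_add_eq_zero_left hx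
  obtain ⟨σ, hσ⟩ := hv.exists_ge_of_ge_prod (hn ▸ (hFeval x ▸ hFx ▸ hv.ge_neg hb) :
    Ge v (Fintype.card (L ≃ₐ[K] L) * δ) (∏ σ : L ≃ₐ[K] L, (x - (σ π : L))))
  have hxπ : Ge v δ (x - π) := by
    have := hv.ge_add hσ (hlow σ)
    rwa [sub_add_sub_cancel] at this
  obtain ⟨hx0, hvx⟩ := hv.map_eq_of_gt_sub hπΩ (hxπ.gt hδ)
  set g : K[X] := (F + C b).map hv.intK.subtype with hg
  have hgm : g.Monic := hGm.map _
  have hgn : g.natDegree = n := by rw [hg, hGm.natDegree_map, hGn]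
  have hgx : aeval x g = 0 := by
    rw [aeval_def, hg, eval₂_map, eval₂_add, eval₂_C]
    exact hx
  have hle : L ≤ K⟮x⟯ := hP _
    (hv.totRam_adjoin hgm hgn hgx hx0 (hvx ▸ hπn))
    (hv.exists_isHomGe hπΩ hπn hrep hF hFn hFπ (mem_adjoin_simple_self K x)
      (Or.inr (hvx ▸ hvπ.le)) (hFx ▸ hv.ge_neg hb))
  have hint : IsIntegral K x := ⟨g, hgm, hgx⟩
  have := adjoin.finiteDimensional hint
  have hfr : Module.finrank K K⟮x⟯ ≤ Module.finrank K L := by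
    rw [adjoin.finrank hint, ← IsGalois.card_aut_eq_finrank, Nat.card_eq_fintype_card, ← hn, ← hgn]
    exact natDegree_le_of_dvd (minpoly.dvd K x hgx) hgm.ne_zero
  have hxL : x ∈ L := by
    rw [eq_of_le_of_finrank_le hle hfr]
    exact mem_adjoin_simple_self K x
  exact ⟨⟨x, hxL⟩, hxπ, by rw [← hFx, hFeval]⟩

end Core

section Main

variable {K Ω : Type} [Field K] [Field Ω] [Algebra K Ω] {v : Ω → ℝ} (hv : IsCDV K Ω v)
  {L : IntermediateField K Ω} [FiniteDimensional K ↥L] [IsGalois K ↥L]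
include hv

/-- If every perturbation `∏ (X - σ π) + c t ^ N` has a root in `L` close to `π`, then the residues
of `(σ π - π) / π ^ N` form a finite subgroup of `k` whose additive polynomial is surjective. -/
lemma IsCDV.finrank_ne_of_forall_exists_prod_sub {p : ℕ} (hp : p.Prime)
    {k : Type} [Field k] [CharP k p] [PerfectField k] {ρ : K → k} (hρ : IsResidueMap v K ρ)
    [Nontrivial (L ≃ₐ[K] L)] {t : K} (ht0 : t ≠ 0) (ht : v (algebraMap K Ω t) = 1)
    {π : L} (hπ : π ≠ 0) (hπn : Fintype.card (L ≃ₐ[K] L) * v (π : Ω) = 1)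
    (hG : ∀ (σ : L ≃ₐ[K] L) (y : L), Ge v 0 (y : Ω) → Gt v 0 ((σ y : Ω) - y))
    {N : ℕ} (hN : 2 ≤ N)
    (hσ : ∀ σ : L ≃ₐ[K] L, σ ≠ 1 → (σ π : Ω) - π ≠ 0 ∧ v ((σ π : Ω) - π) = N * v (π : Ω))
    (hroot : ∀ b : hv.intK, Ge v N (hv.intMap b) → ∃ x : L, Ge v (N * v (π : Ω)) ((x : Ω) - π) ∧
      ∏ σ : L ≃ₐ[K] L, ((x : Ω) - (σ π : L)) = - hv.intMap b)
    {l : Type} [Field l] [Algebra k l] [IsGalois k l] : Module.finrank k l ≠ p := by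
  set n := Fintype.card (L ≃ₐ[K] L) with hn
  have hπΩ : (π : Ω) ≠ 0 := ZeroMemClass.coe_eq_zero.not.2 hπ
  have htΩ : algebraMap K Ω t ≠ 0 := by simpa using ht0
  have hvπ : 0 < v (π : Ω) := by
    by_contra h; push Not at h; nlinarith [(Nat.cast_nonneg n : (0:ℝ) ≤ n)]
  have hπN : (π : Ω) ^ N ≠ 0 := pow_ne_zero _ hπΩ
  obtain ⟨ι, hι⟩ := hv.exists_residue_embedding hρ
  have hlift : ∀ y : L, Ge v 0 (y : Ω) → ∃ c : k, ι c = hv.res y := by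
    intro y hy
    obtain ⟨c, hc⟩ := hv.exists_residue_lift L hρ hG hy
    exact ⟨hv.redK hρ c, by rw [hι, eq_comm, hv.res_eq_iff hy (hv.ge_intMap c)]; exact hc⟩
  have hquot : ∀ y : Ω, Ge v (N * v (π : Ω)) y → Ge v 0 (y / (π : Ω) ^ N) := by
    intro y hy
    have h1 : Ge v (-(N * v (π : Ω))) ((π : Ω) ^ N)⁻¹ :=
      Or.inr (by rw [hv.map_inv hπN, hv.map_pow hπΩ])
    simpa [div_eq_mul_inv] using hv.ge_mul hy h1
  have hσge : ∀ σ : L ≃ₐ[K] L, Ge v (N * v (π : Ω)) ((σ π : Ω) - π) := by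
    intro σ
    rcases eq_or_ne σ 1 with rfl | h
    · exact Or.inl (by simp)
    · exact Or.inr (hσ σ h).2.ge
  set A : (L ≃ₐ[K] L) → L := fun σ => (σ π - π) / π ^ N with hA
  have hAΩ : ∀ σ, (A σ : Ω) = ((σ π : Ω) - π) / (π : Ω) ^ N := fun σ => rfl
  have hAge : ∀ σ, Ge v 0 (A σ : Ω) := fun σ => hAΩ σ ▸ hquot _ (hσge σ)
  choose a ha using fun σ => hlift (A σ) (hAge σ)
  have hmul : ∀ σ τ, a (σ * τ) = a σ + a τ := by
    intro σ τ
    apply ι.injective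
    rw [_root_.map_add, ha, ha, ha, ← hv.res_add (hAge _) (hAge _),
      hv.res_eq_iff (hAge _) (hv.ge_add (hAge _) (hAge _))]
    have hσπ : (σ π : Ω) ≠ 0 := by simpa using hπ
    set q : Ω := (σ π : Ω) / π with hq
    have hvq : v q = 0 := by
      rw [hq, hv.map_div hσπ hπΩ, hv.galois_inv, sub_self]
    have hq1 : Gt v 0 (q - 1) := by
      have h1 : q - 1 = ((σ π : Ω) - π) * (π : Ω)⁻¹ := by rw [hq]; field_simp
      have h2 := hv.ge_mul (hσge σ) (Or.inr (hv.map_inv hπΩ).ge : Ge v (-v (π : Ω)) (π : Ω)⁻¹)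
      rw [h1]
      refine h2.gt ?_
      have : (2 : ℝ) ≤ N := by exact_mod_cast hN
      nlinarith
    have hqN : Gt v 0 (q ^ N - 1) := by
      have hq0 : Ge v 0 q := Or.inr hvq.ge
      rw [← hv.res_eq_iff (by simpa using hv.ge_pow hq0 N) hv.ge_one, hv.res_pow hq0,
        (hv.res_eq_iff hq0 hv.ge_one).2 hq1, ← hv.res_pow hv.ge_one, one_pow]
    have hσA : Ge v 0 (σ (A τ) : Ω) := hv.ge_galois L σ (hAge τ)
    have hσAΩ : (σ (A τ) : Ω) = ((σ (τ π) : Ω) - σ π) / (σ π : Ω) ^ N := by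
      have : σ (A τ) = (σ (τ π) - σ π) / σ π ^ N := by simp [hA]
      rw [this]; rfl
    have hsplit : (A (σ * τ) : Ω) - (A σ + A τ) =
        (q ^ N - 1) * (σ (A τ) : Ω) + ((σ (A τ) : Ω) - A τ) := by
      have h3 : (A (σ * τ) : Ω) = ((σ (τ π) : Ω) - π) / (π : Ω) ^ N := rfl
      have h4 : q ^ N * (σ (A τ) : Ω) = ((σ (τ π) : Ω) - σ π) / (π : Ω) ^ N := by
        rw [hσAΩ, hq, div_pow]
        field_simp
      rw [sub_mul, h4, h3, hAΩ σ]
      ring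
    rw [hsplit]
    exact hv.gt_add (by simpa using hv.gt_mul hqN hσA) (hG σ _ (hAge τ))
  have ha1 : ∀ σ, a σ = 0 → σ = 1 := by
    intro σ h
    by_contra hne
    obtain ⟨h0, h1⟩ := hσ σ hne
    have h2 : Gt v 0 (A σ : Ω) := by
      rw [← hv.res_eq_zero_iff (hAge σ), ← ha, h, _root_.map_zero]
    refine h2.not_le (hAΩ σ ▸ div_ne_zero h0 hπN) ?_
    rw [hAΩ, hv.map_div h0 hπN, h1, hv.map_pow hπΩ, sub_self]
  have hinj : Function.Injective a := by
    intro σ τ h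
    have h1 : a (σ⁻¹ * τ) = 0 := by
      have := hmul σ (σ⁻¹ * τ)
      rw [mul_inv_cancel_left, h] at this
      simpa using this
    exact (inv_mul_eq_one.1 (ha1 _ h1))
  refine finrank_ne_of_prod_sub_surjective hp a hinj hmul fun c => ?_
  set U : L := (algebraMap K L t / π ^ n) ^ N with hU
  have hUΩ : (U : Ω) = (algebraMap K Ω t / (π : Ω) ^ n) ^ N := rfl
  have htπ : algebraMap K Ω t / (π : Ω) ^ n ≠ 0 := div_ne_zero htΩ (pow_ne_zero _ hπΩ)
  have hvU : v (U : Ω) = 0 := by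
    rw [hUΩ, hv.map_pow htπ, hv.map_div htΩ (pow_ne_zero _ hπΩ), hv.map_pow hπΩ, ht, hπn, sub_self,
      mul_zero]
  have hUge : Ge v 0 (U : Ω) := Or.inr hvU.ge
  obtain ⟨η, hη⟩ := hlift U hUge
  have hη0 : η ≠ 0 := by
    rintro rfl
    rw [_root_.map_zero, eq_comm, hv.res_eq_zero_iff hUge] at hη
    exact hη.not_le (hUΩ ▸ pow_ne_zero _ htπ) hvU.le
  obtain ⟨d, hd⟩ := hv.redK_surjective hρ (-(c / η))
  have htint : Ge v 0 (algebraMap K Ω t) := Or.inr (by rw [ht]; exact zero_le_one)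
  set b : hv.intK := d * ⟨t, htint⟩ ^ N with hb
  have hbΩ : hv.intMap b = hv.intMap d * algebraMap K Ω t ^ N := by
    rw [hb, _root_.map_mul, _root_.map_pow]; rfl
  obtain ⟨x, hx, hprod⟩ := hroot b (by
    rw [hbΩ]
    have := hv.ge_pow (Or.inr ht.ge : Ge v 1 (algebraMap K Ω t)) N
    simpa using hv.ge_mul (hv.ge_intMap d) this)
  set W : L := (x - π) / π ^ N with hW
  have hWΩ : (W : Ω) = ((x : Ω) - π) / (π : Ω) ^ N := rfl
  have hWge : Ge v 0 (W : Ω) := hWΩ ▸ hquot _ hx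
  obtain ⟨w, hw⟩ := hlift W hWge
  refine ⟨w, ι.injective ?_⟩
  have hWA : ∏ σ, ((W : Ω) - A σ) = - hv.intMap d * U := by
    have h1 : ∀ σ, (W : Ω) - A σ = ((x : Ω) - (σ π : L)) / (π : Ω) ^ N := fun σ => by
      rw [hWΩ, hAΩ, ← sub_div, sub_sub_sub_cancel_right]
    simp only [h1]
    rw [Finset.prod_div_distrib, hprod, hbΩ, Finset.prod_const, Finset.card_univ, ← hn, hUΩ,
      div_pow, ← pow_mul, ← pow_mul, mul_comm N n]
    ring
  have hd' : hv.res (- hv.intMap d) = ι (c / η) := by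
    rw [← _root_.map_neg, ← hι, _root_.map_neg, hd, neg_neg]
  rw [_root_.map_prod]
  have h2 : ∀ σ, ι (w - a σ) = hv.res ((W : Ω) - A σ) := fun σ => by
    rw [_root_.map_sub, hw, ha, hv.res_sub hWge (hAge σ)]
  simp only [h2]
  rw [← hv.res_prod _ _ fun σ => hv.ge_sub hWge (hAge σ), hWA,
    hv.res_mul (hv.ge_neg (hv.ge_intMap d)) hUge, hd', ← hη, ← _root_.map_mul,
    div_mul_cancel₀ _ hη0]

/-- The main argument, for a normalized valuation, with `δ` the unique lower ramification break. -/
theorem IsCDV.finrank_ne [IsAlgClosed Ω] {p : ℕ} (hp : p.Prime)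
    {k : Type} [Field k] [CharP k p] [PerfectField k] {ρ : K → k} (hρ : IsResidueMap v K ρ)
    [Nontrivial (L ≃ₐ[K] L)] {t : K} (ht0 : t ≠ 0) (ht : v (algebraMap K Ω t) = 1)
    {δ : ℝ} (hδ : 0 < δ)
    (hlow : ∀ σ : L ≃ₐ[K] L, σ ≠ 1 → ∀ y : L, Ge v 0 (y : Ω) → Ge v δ ((σ y : Ω) - y))
    (hup : ∀ σ : L ≃ₐ[K] L, σ ≠ 1 →
      ∀ r, (∀ y : L, Ge v 0 (y : Ω) → Ge v r ((σ y : Ω) - y)) → r ≤ δ)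
    (hP : ∀ E : IntermediateField K Ω, TotRam v ⊥ E →
      (∃ f, IsHomGe v L E (Fintype.card (L ≃ₐ[K] L) * δ) f) → L ≤ E)
    {l : Type} [Field l] [Algebra k l] [IsGalois k l] : Module.finrank k l ≠ p := by
  have hlow' : ∀ (σ : L ≃ₐ[K] L) (y : L), Ge v 0 (y : Ω) → Ge v δ ((σ y : Ω) - y) := by
    intro σ y hy
    rcases eq_or_ne σ 1 with rfl | h
    · exact Or.inl (by simp)
    · exact hlow σ h y hy
  have hG : ∀ (σ : L ≃ₐ[K] L) (y : L), Ge v 0 (y : Ω) → Gt v 0 ((σ y : Ω) - y) :=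
    fun σ y hy => (hlow' σ y hy).gt hδ
  obtain ⟨π, hπ, hπn, hgen, hspan⟩ := hv.exists_uniformizer_span L ht0 ht
    fun y hy => hv.exists_residue_lift L hρ hG hy
  set n := Fintype.card (L ≃ₐ[K] L) with hn
  have hn0 : n ≠ 0 := Fintype.card_ne_zero
  have hπΩ : (π : Ω) ≠ 0 := ZeroMemClass.coe_eq_zero.not.2 hπ
  have hvπ : 0 < v (π : Ω) := by
    by_contra h; push Not at h; nlinarith [(Nat.cast_nonneg n : (0:ℝ) ≤ n)]
  have hπge : Ge v 0 (π : Ω) := Or.inr hvπ.le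
  have hrep : ∀ y, IsInt v L y → ∃ P : Polynomial hv.intK, P.eval₂ hv.intMap (π : Ω) = y :=
    fun y hy => hv.exists_eval₂_eq hπ hπn hspan hy
  have hσ : ∀ σ : L ≃ₐ[K] L, σ ≠ 1 → (σ π : Ω) - π ≠ 0 ∧ v ((σ π : Ω) - π) = δ :=
    fun σ h => hv.map_galois_sub hπge hrep (hlow σ h) (hup σ h)
  obtain ⟨σ₀, hσ₀⟩ := exists_ne (1 : L ≃ₐ[K] L)
  obtain ⟨z, hz⟩ := hgen (σ₀ π - π) (ZeroMemClass.coe_eq_zero.not.1 (hσ σ₀ hσ₀).1)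
  have hzδ : (z : ℝ) * v (π : Ω) = δ := hz.symm.trans (hσ σ₀ hσ₀).2
  have hz0 : 0 < z := by
    have : (0 : ℝ) < z := pos_of_mul_pos_left (hzδ ▸ hδ) hvπ.le
    exact_mod_cast this
  obtain ⟨N, rfl⟩ := Int.eq_ofNat_of_zero_le hz0.le
  push_cast at hzδ
  have hnδ : n * δ = N := by rw [← hzδ, mul_left_comm, hπn, mul_one]
  have hN : 2 ≤ N := by
    by_contra! hN
    have hN1 : (n : ℝ) * δ ≤ 1 := by rw [hnδ]; exact_mod_cast (by omega : N ≤ 1)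
    obtain ⟨F, hF, hFn, hFprod⟩ := hv.exists_map_eq_prod L hπge
    have hFeval : ∀ x, F.eval₂ hv.intMap x = ∏ σ : L ≃ₐ[K] L, (x - (σ π : L)) := fun x => by
      rw [← Polynomial.eval_map, hFprod, Polynomial.eval_prod]; simp
    have hσπ : ∀ σ : L ≃ₐ[K] L, (0 : Ω) - (σ π : L) ≠ 0 := fun σ => by simpa using hπ
    have hle : L ≤ ⊥ := hP ⊥ totRam_bot (hv.exists_isHomGe hπΩ hπn hrep hF hFn
      (by rw [hFeval]; exact Finset.prod_eq_zero (Finset.mem_univ 1) (by simp)) (zero_mem _)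
      Ge.zero (Or.inr (by
        rw [hFeval, hv.map_prod _ _ fun σ _ => hσπ σ]
        simp only [zero_sub, hv.map_neg, hv.galois_inv, Finset.sum_const, Finset.card_univ,
          nsmul_eq_mul]
        rwa [← hn, hπn])))
    refine hσ₀ (AlgEquiv.ext fun y => ?_)
    obtain ⟨c, hc⟩ := IntermediateField.mem_bot.1 (hle y.2)
    have : y = algebraMap K L c := Subtype.ext hc.symm
    rw [this, AlgEquiv.commutes, AlgEquiv.commutes]
  refine hv.finrank_ne_of_forall_exists_prod_sub hp hρ ht0 ht hπ hπn hG hN ?_ fun b hb => ?_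
  · rwa [hzδ]
  · rw [hzδ]
    refine hv.exists_prod_sub_eq hπ hπn hrep (fun σ => hlow' σ π hπge) ?_ hP (by rwa [← hn, hnδ])
    rw [← hzδ]
    have : (2 : ℝ) ≤ N := by exact_mod_cast hN
    nlinarith

end Main

section Rescale

variable {K Ω : Type} [Field K] [Field Ω] [Algebra K Ω] {v : Ω → ℝ}

lemma ge_div_iff {g r : ℝ} (hg : 0 < g) {x : Ω} :
    Ge (fun y => v y / g) r x ↔ Ge v (r * g) x := by
  simp only [Ge, le_div_iff₀ hg]

lemma gt_div_iff {g : ℝ} (hg : 0 < g) {x : Ω} : Gt (fun y => v y / g) 0 x ↔ Gt v 0 x := by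
  simp only [Gt, lt_div_iff₀ hg, zero_mul]

lemma ge_zero_div_iff {g : ℝ} (hg : 0 < g) {x : Ω} : Ge (fun y => v y / g) 0 x ↔ Ge v 0 x := by
  rw [ge_div_iff hg, zero_mul]

lemma isInt_div_iff {g : ℝ} (hg : 0 < g) {E : IntermediateField K Ω} {x : Ω} :
    IsInt (fun y => v y / g) E x ↔ IsInt v E x :=
  and_congr_right fun _ => ge_zero_div_iff hg

lemma totRam_div_iff {g : ℝ} (hg : 0 < g) {F E : IntermediateField K Ω} :
    TotRam (fun y => v y / g) F E ↔ TotRam v F E := by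
  refine forall_congr' fun x => imp_congr (isInt_div_iff hg) (exists_congr fun c => ?_)
  exact and_congr_right fun _ => and_congr (ge_zero_div_iff hg) (gt_div_iff hg)

lemma isIntK_div_iff {g : ℝ} (hg : 0 < g) {x : K} :
    IsIntK (fun y => v y / g) K x ↔ IsIntK v K x := by
  rw [isIntK_iff, isIntK_iff, ge_zero_div_iff hg]

lemma isResidueMap_div {g : ℝ} (hg : 0 < g) {k : Type} [Field k] {ρ : K → k}
    (hρ : IsResidueMap v K ρ) : IsResidueMap (fun y => v y / g) K ρ := by
  obtain ⟨h1, h2, h3, h4, h5⟩ := hρ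
  simp only [IsResidueMap, isIntK_div_iff hg, lt_div_iff₀ hg, zero_mul]
  exact ⟨h1, h2, h3, h4, h5⟩

/-- `vRel v F` is `v` multiplied by the ramification index, so that a bound for `vRel` is a bound
for any rescaling of `v`. -/
lemma inId_iff_ge_div {g : ℝ} (hg : 0 < g) {F : IntermediateField K Ω} (hs : 0 < ramIdx v F)
    {r : ℝ} {x : Ω} : InId v F r x ↔ Ge (fun y => v y / g) (r / (ramIdx v F * g)) x := by
  have h : r / (ramIdx v F * g) * g = r / ramIdx v F := by field_simp
  rw [ge_div_iff hg, h]
  simp only [InId, vRel, Ge, div_le_iff₀ hs]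

variable (hv : IsCDV K Ω v)
include hv

lemma IsCDV.ramIdx_bot_pos : 0 < ramIdx v (⊥ : IntermediateField K Ω) := by
  obtain ⟨t, ht⟩ := hv.exists_uniformizer
  refine inv_pos.2 ?_
  obtain ⟨b, hb, hb1, hb0⟩ : ∃ b : ℝ, 0 < b ∧ b ≤ 1 ∧ (0 < v 0 → b ≤ v 0) := by
    by_cases h : 0 < v 0
    · exact ⟨min (v 0) 1, lt_min h zero_lt_one, min_le_right _ _, fun _ => min_le_left _ _⟩
    · exact ⟨1, zero_lt_one, le_rfl, fun h' => absurd h' h⟩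
  refine hb.trans_le (le_csInf ⟨1, zero_lt_one, _, ⟨t, rfl⟩, ht⟩ ?_)
  rintro r ⟨hr, x, hx, rfl⟩
  obtain ⟨c, rfl⟩ := IntermediateField.mem_bot.1 hx
  rcases eq_or_ne c 0 with rfl | hc
  · rw [_root_.map_zero] at hr ⊢
    exact hb0 hr
  · obtain ⟨z, hz⟩ := hv.int_valued c hc
    rw [hz] at hr ⊢
    have : 0 < z := by exact_mod_cast hr
    exact hb1.trans (by exact_mod_cast this)

/-- The value group of `K` is generated by its least positive element. -/
lemma IsCDV.exists_generator_base {y : K} (hy0 : y ≠ 0) (hy : v (algebraMap K Ω y) ≠ 0) :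
    ∃ (g : ℝ) (t : K), 0 < g ∧ t ≠ 0 ∧ v (algebraMap K Ω t) = g ∧
      ∀ x : K, x ≠ 0 → ∃ z : ℤ, v (algebraMap K Ω x) = z * g := by
  have hne : ∀ {x : K}, x ≠ 0 → algebraMap K Ω x ≠ 0 := fun h => by simpa using h
  have hex : ∃ g : ℕ, 0 < g ∧ ∃ t : K, t ≠ 0 ∧ v (algebraMap K Ω t) = g := by
    obtain ⟨z, hz⟩ := hv.int_valued y hy0
    have hz0 : z ≠ 0 := by rintro rfl; exact hy (by simpa using hz)
    refine ⟨z.natAbs, Int.natAbs_pos.2 hz0, ?_⟩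
    rcases le_total 0 z with h | h
    · exact ⟨y, hy0, by rw [hz, Nat.cast_natAbs, abs_of_nonneg h]⟩
    · refine ⟨y⁻¹, inv_ne_zero hy0, ?_⟩
      rw [_root_.map_inv₀, hv.map_inv (hne hy0), hz, Nat.cast_natAbs, abs_of_nonpos h]
      push_cast; rfl
  obtain ⟨hg, t, ht0, ht⟩ := Nat.find_spec hex
  set g := Nat.find hex
  refine ⟨g, t, by exact_mod_cast hg, ht0, ht, fun x hx => ?_⟩
  obtain ⟨z, hz⟩ := hv.int_valued x hx
  have hmod := Int.emod_nonneg z (by omega : (g : ℤ) ≠ 0)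
  have hlt := Int.emod_lt_of_pos z (by omega : (0 : ℤ) < g)
  have hval : v (algebraMap K Ω (x / t ^ (z / g))) = ((z % g : ℤ) : ℝ) := by
    rw [_root_.map_div₀, _root_.map_zpow₀, hv.map_div (hne hx) (zpow_ne_zero _ (hne ht0)),
      hv.map_zpow (hne ht0), hz, ht, Int.emod_def]
    push_cast; ring
  have h0 : z % g = 0 := by
    by_contra h
    refine Nat.find_min hex (m := (z % g).toNat) (by omega)
      ⟨by omega, x / t ^ (z / g), div_ne_zero hx (zpow_ne_zero _ ht0), ?_⟩
    rw [hval, ← Int.cast_natCast (R := ℝ) (z % g).toNat, Int.toNat_of_nonneg hmod]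
  refine ⟨z / g, ?_⟩
  rw [hz]
  exact_mod_cast (Int.ediv_mul_cancel (Int.dvd_of_emod_eq_zero h0)).symm

lemma IsCDV.div {g : ℝ} (hg : 0 < g) {t : K} (ht : v (algebraMap K Ω t) = g)
    (hgen : ∀ x : K, x ≠ 0 → ∃ z : ℤ, v (algebraMap K Ω x) = z * g) :
    IsCDV K Ω (fun x => v x / g) where
  map_mul x y hx hy := by rw [hv.map_mul x y hx hy, add_div]
  add_ge x y hx hy hxy := by
    rw [min_div_div_right hg.le]
    exact div_le_div_of_nonneg_right (hv.add_ge x y hx hy hxy) hg.le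
  int_valued x hx := by
    obtain ⟨z, hz⟩ := hgen x hx
    exact ⟨z, by rw [hz, mul_div_cancel_right₀ _ hg.ne']⟩
  exists_uniformizer := ⟨t, by rw [ht, div_self hg.ne']⟩
  galois_inv E σ x := by rw [hv.galois_inv]
  complete x hx := by
    simp only [le_div_iff₀ hg] at hx ⊢
    obtain ⟨y, hy⟩ := hv.complete x fun N => by
      obtain ⟨n₀, h⟩ := hx (N / g)
      exact ⟨n₀, fun i j hi hj => by simpa only [div_mul_cancel₀ _ hg.ne'] using h i j hi hj⟩
    exact ⟨y, fun N => hy (N * g)⟩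

end Rescale

section Break

variable {K Ω : Type} [Field K] [Field Ω] [Algebra K Ω] {v : Ω → ℝ}

lemma mem_relGal_bot {L : IntermediateField K Ω} (σ : L ≃ₐ[K] L) : σ ∈ relGal ⊥ L := by
  intro x hx
  obtain ⟨c, hc⟩ := IntermediateField.mem_bot.1 hx
  have : x = algebraMap K L c := Subtype.ext hc.symm
  rw [this, AlgEquiv.commutes]

lemma lowerAt_bot_iff_ge_div {g : ℝ} (hg : 0 < g) (hs : 0 < ramIdx v (⊥ : IntermediateField K Ω))
    {L : IntermediateField K Ω} {σ : L ≃ₐ[K] L} {i : ℝ} :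
    lowerAt v ⊥ L σ i ↔ ∀ y : L, Ge (fun x => v x / g) 0 (y : Ω) →
      Ge (fun x => v x / g) (i / (ramIdx v (⊥ : IntermediateField K Ω) * g)) ((σ y : Ω) - y) := by
  simp only [lowerAt, mem_relGal_bot, true_and, ← inId_iff_ge_div hg hs, ge_zero_div_iff hg]
  refine forall_congr' fun y => imp_congr (and_iff_right y.2) (or_congr_left ?_)
  rw [sub_eq_zero]
  exact Subtype.coe_injective.eq_iff.symm

lemma uBreak_bot_eq {L : IntermediateField K Ω} [FiniteDimensional K ↥L]
    (h : UniqueJump v L) :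
    uBreak v ⊥ L = Fintype.card (L ≃ₐ[K] L) * iBreak v ⊥ L := by
  have hset : {σ : L ≃ₐ[K] L | σ ∈ relGal ⊥ L ∧ σ ≠ 1} =
      ((Finset.univ.erase 1 : Finset (L ≃ₐ[K] L)) : Set (L ≃ₐ[K] L)) := by
    ext σ; simp [mem_relGal_bot]
  have hsum : ∀ σ ∈ (Finset.univ.erase 1 : Finset (L ≃ₐ[K] L)),
      min (iFon v ⊥ L σ) (iBreak v ⊥ L) = iBreak v ⊥ L := fun σ hσ => by
    rw [h σ (Finset.ne_of_mem_erase hσ), min_self]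
  rw [uBreak, phiT, hset, finsum_mem_coe_finset, Finset.sum_congr rfl hsum, Finset.sum_const,
    Finset.card_erase_of_mem (Finset.mem_univ _), Finset.card_univ, nsmul_eq_mul,
    Nat.cast_sub Fintype.card_pos]
  push_cast; ring

lemma IsCDV.bddAbove_galois (hv : IsCDV K Ω v) {L : IntermediateField K Ω}
    {t : K} (ht0 : t ≠ 0) (ht : v (algebraMap K Ω t) = 1) {σ : L ≃ₐ[K] L} (hσ : σ ≠ 1) :
    BddAbove {r : ℝ | ∀ y : L, Ge v 0 (y : Ω) → Ge v r ((σ y : Ω) - y)} := by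
  obtain ⟨y, hy⟩ : ∃ y, σ y ≠ y := by
    by_contra! h
    exact hσ (AlgEquiv.ext h)
  obtain ⟨N, hN⟩ := hv.exists_pow_mul_ge L ht0 ht y 0
  refine ⟨_, fun r hr => (hr _ hN).resolve_left ?_⟩
  have ht' : algebraMap K L t ≠ 0 := by simpa using ht0
  have : σ (algebraMap K L t ^ N * y) - algebraMap K L t ^ N * y ≠ 0 := by
    rw [_root_.map_mul, _root_.map_pow, AlgEquiv.commutes, ← mul_sub]
    exact mul_ne_zero (pow_ne_zero _ ht') (sub_ne_zero.2 hy)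
  exact ZeroMemClass.coe_eq_zero.not.2 this

variable {L : IntermediateField K Ω} [FiniteDimensional K ↥L] [IsGalois K ↥L]

/-- A positive ramification break forces the valuation of `K` to be nontrivial. -/
lemma IsCDV.exists_map_ne_zero (hv : IsCDV K Ω v) {σ : L ≃ₐ[K] L} (hσ : σ ≠ 1)
    (hi : 0 < iFon v ⊥ L σ) : ∃ y : K, y ≠ 0 ∧ v (algebraMap K Ω y) ≠ 0 := by
  by_contra! h
  have hL : ∀ y : L, y ≠ 0 → v (y : Ω) = 0 := by
    intro y hy
    have h1 := hv.map_norm L hy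
    rw [h _ (Algebra.norm_ne_zero_iff.2 hy)] at h1
    exact (mul_eq_zero.1 h1.symm).resolve_left (Nat.cast_ne_zero.2 Fintype.card_ne_zero)
  refine hi.not_ge (Real.sSup_nonpos fun i hlow => ?_)
  obtain ⟨y, hy⟩ : ∃ y, σ y ≠ y := by
    by_contra! h
    exact hσ (AlgEquiv.ext h)
  have hy0 : y ≠ 0 := by rintro rfl; simp at hy
  have := (hlow.2 y ⟨y.2, Or.inr (hL y hy0).ge⟩).resolve_left hy
  have h2 : v ((σ y : Ω) - y) = 0 := hL (σ y - y) (sub_ne_zero.2 hy)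
  rwa [vRel, h2, zero_mul] at this

end Break

end Fontaine

/-- Proposition 5.1 (1). Let `L/K` be a finite wild Galois extension
with a unique jump in the ramification filtration, `m = u_{L/K}`. If `L/K` satisfies
(P_m^tr) then the residue field `k` has no Galois extension of degree `p`. -/
theorem statement5
    (K Ω : Type) [Field K] [Field Ω] [Algebra K Ω] [IsAlgClosure K Ω]
    (v : Ω → ℝ) (hv : IsCDV K Ω v)
    (p : ℕ) (hp : p.Prime)
    (k : Type) [Field k] [CharP k p] [PerfectField k]
    (ρ : K → k) (hρ : IsResidueMap v K ρ)
    (L : IntermediateField K Ω) [FiniteDimensional K ↥L] [IsGalois K ↥L]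
    (hwild : 1 < uBreak v ⊥ L) (huniq : UniqueJump v L)
    (m : ℕ) (hm : (m : ℝ) = uBreak v ⊥ L)
    (hP : PropPtr v ⊥ L (m : ℝ)) :
    ∀ (k'' : Type) [Field k''] [Algebra k k''] [IsGalois k k''],
      Module.finrank k k'' ≠ p := by
  intro k'' _ _ _
  have hΩ : IsAlgClosed Ω := IsAlgClosure.isAlgClosed K
  have hs := hv.ramIdx_bot_pos
  have hu := uBreak_bot_eq huniq
  have hI : 0 < iBreak v ⊥ L :=
    pos_of_mul_pos_right (hu ▸ zero_lt_one.trans hwild) (Nat.cast_nonneg _)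
  obtain ⟨σ₀, hσ₀⟩ : ∃ σ : L ≃ₐ[K] L, σ ≠ 1 := by
    by_contra! h
    have : {i : ℝ | ∃ σ : L ≃ₐ[K] L, σ ≠ 1 ∧ lowerAt v ⊥ L σ i} = ∅ := by
      ext i; simp [h]
    rw [iBreak, this, Real.sSup_empty] at hI
    exact hI.false
  have : Nontrivial (L ≃ₐ[K] L) := ⟨σ₀, 1, hσ₀⟩
  obtain ⟨y, hy0, hy⟩ := hv.exists_map_ne_zero hσ₀ (huniq σ₀ hσ₀ ▸ hI)
  obtain ⟨g, t, hg, ht0, ht, hgen⟩ := hv.exists_generator_base hy0 hy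
  have hv' := hv.div hg ht hgen
  have ht' : v (algebraMap K Ω t) / g = 1 := by rw [ht, div_self hg.ne']
  have hsg : 0 < ramIdx v (⊥ : IntermediateField K Ω) * g := mul_pos hs hg
  refine hv'.finrank_ne (L := L) hp (isResidueMap_div hg hρ) ht0 ht'
    (δ := iBreak v ⊥ L / (ramIdx v (⊥ : IntermediateField K Ω) * g)) (div_pos hI hsg)
    (fun σ hσ y hy => ?_) (fun σ hσ r hr => ?_) fun E hE => ?_
  · by_cases h0 : (σ y : Ω) - y = 0
    · exact Or.inl h0
    rw [← inId_iff_ge_div hg hs]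
    refine Or.inr ?_
    rw [← huniq σ hσ]
    refine csSup_le ?_ fun i hi => (hi.2 y ⟨y.2, (ge_zero_div_iff hg).1 hy⟩).resolve_left
      fun h => h0 (by rw [h, sub_self])
    by_contra! h
    rw [← huniq σ hσ, iFon, h, Real.sSup_empty] at hI
    exact hI.false
  · rw [le_div_iff₀ hsg, ← huniq σ hσ]
    obtain ⟨B, hB⟩ := hv'.bddAbove_galois ht0 ht' hσ
    refine le_csSup ⟨B * _, fun i hi => (div_le_iff₀ hsg).1 (hB ?_)⟩ ?_
    · exact (lowerAt_bot_iff_ge_div hg hs).1 hi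
    · refine (lowerAt_bot_iff_ge_div hg hs).2 ?_
      rwa [mul_div_cancel_right₀ _ hsg.ne']
  · rintro ⟨f, hf⟩
    refine hP E bot_le ((totRam_div_iff hg).1 hE) ⟨f, ?_⟩
    rw [← mul_div_assoc, ← hu, ← hm] at hf
    simpa only [IsHomGe, IsHomMod, isInt_div_iff hg, inId_iff_ge_div hg hs] using hf
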